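/- (Theorem 2.2, Laplace transform of the exponential functional.) Assume m < 0 and 0 < θ < α, and let C_θ ∈ (0,∞) be the constant such that I_{α,ψ}(x^α) ∼ C_θ x^θ I_{α,ψ_θ}(x^α) as x → ∞. Define N_{α,ψ,θ}(x) = I_{α,ψ}(x) − C_θ·x^{θ/α}·I_{α,ψ_θ}(x) for x ≥ 0. Then there exists a Borel probability measure μ on (0,∞) (the law of the exponential functional Σ_∞ = ∫₀^∞ e^{α ξ_s} ds of the associated Lévy process) such that N_{α,ψ,θ}(q) = ∫₀^∞ e^{−q·t} μ(dt) for all q ≥ 0; in particular N_{α,ψ,θ}(0) = 1 and N_{α,ψ,θ} is nonincreasing on [0,∞). -/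

import Mathlib

open MeasureTheory Real Set Filter Topology

/-- The Laplace exponent of a spectrally negative infinitely divisible random variable. -/
noncomputable def psi (σ b : ℝ) (ν : Measure ℝ) (u : ℝ) : ℝ :=
  b * u + σ / 2 * u ^ 2 +
    ∫ r in Ioi (0 : ℝ), (Real.exp (-u * r) - 1 + (if r ≤ 1 then u * r else 0)) ∂ν

/-- The coefficients `a_n(ψ;α) = (∏_{k=1}^n ψ(αk))⁻¹`, with `a_0 = 1`. -/
noncomputable def coeffA (ψ : ℝ → ℝ) (α : ℝ) (n : ℕ) : ℝ :=
  (∏ k ∈ Finset.range n, ψ (α * (k + 1)))⁻¹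

/-- The power series `I_{α,ψ}(x) = Σ_{n≥0} a_n(ψ;α) x^n`. -/
noncomputable def Iser (ψ : ℝ → ℝ) (α : ℝ) (x : ℝ) : ℝ :=
  ∑' n : ℕ, coeffA ψ α n * x ^ n

/-- The function `N_{α,ψ,θ}(x) = I_{α,ψ}(x) - C_θ x^{θ/α} I_{α,ψ_θ}(x)`. -/
noncomputable def Nfun (ψ ψθ : ℝ → ℝ) (α θ C : ℝ) (x : ℝ) : ℝ :=
  Iser ψ α x - C * x ^ (θ / α) * Iser ψθ α x

/-- `φ` is, on `[0,∞)`, the Laplace transform of a probability measure carried by `[0,∞)`. -/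
def IsLaplace (φ : ℝ → ℝ) : Prop :=
  ∃ μ : Measure ℝ, IsProbabilityMeasure μ ∧ μ (Iio 0) = 0 ∧
    ∀ q : ℝ, 0 ≤ q → φ q = ∫ t, Real.exp (-q * t) ∂μ

lemma ae_nonneg_of_measure_Iio {μ : Measure ℝ} (h : μ (Iio 0) = 0) : ∀ᵐ t ∂μ, 0 ≤ t := by
  rw [ae_iff]
  convert h using 2
  ext t
  simp

lemma integrable_exp_neg_mul {μ : Measure ℝ} [IsProbabilityMeasure μ] (h : μ (Iio 0) = 0)
    {q : ℝ} (hq : 0 ≤ q) : Integrable (fun t => Real.exp (-q * t)) μ := by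
  refine (integrable_const (1 : ℝ)).mono' (by fun_prop) ?_
  filter_upwards [ae_nonneg_of_measure_Iio h] with t ht
  rw [Real.norm_eq_abs, abs_of_pos (Real.exp_pos _), Real.exp_le_one_iff]
  nlinarith

lemma IsLaplace.congr {φ φ' : ℝ → ℝ} (h : IsLaplace φ) (hφ : ∀ q, 0 ≤ q → φ q = φ' q) :
    IsLaplace φ' := by
  obtain ⟨μ, h1, h2, h3⟩ := h
  exact ⟨μ, h1, h2, fun q hq => by rw [← hφ q hq, h3 q hq]⟩

lemma IsLaplace.nonneg {φ : ℝ → ℝ} (h : IsLaplace φ) {q : ℝ} (hq : 0 ≤ q) : 0 ≤ φ q := by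
  obtain ⟨μ, h1, h2, h3⟩ := h
  rw [h3 q hq]
  positivity

lemma IsLaplace.antitoneOn {φ : ℝ → ℝ} (h : IsLaplace φ) : AntitoneOn φ (Ici 0) := by
  obtain ⟨μ, h1, h2, h3⟩ := h
  intro p hp q hq hpq
  rw [h3 q hq, h3 p hp]
  refine integral_mono_ae (integrable_exp_neg_mul h2 hq) (integrable_exp_neg_mul h2 hp) ?_
  filter_upwards [ae_nonneg_of_measure_Iio h2] with t ht
  apply Real.exp_le_exp.2
  nlinarith

lemma IsLaplace.zero {φ : ℝ → ℝ} (h : IsLaplace φ) : φ 0 = 1 := by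
  obtain ⟨μ, h1, h2, h3⟩ := h
  simp [h3 0 le_rfl]

lemma IsLaplace.le_one {φ : ℝ → ℝ} (h : IsLaplace φ) {q : ℝ} (hq : 0 ≤ q) : φ q ≤ 1 := by
  rw [← h.zero]
  exact h.antitoneOn self_mem_Ici hq hq

lemma isLaplace_one : IsLaplace (fun _ => 1) :=
  ⟨Measure.dirac 0, inferInstance, by simp, fun q _ => by simp⟩

/-- Tail bound for a measure on the half line in terms of its Laplace transform near `0`. -/
lemma measure_compl_Icc_le {μ : Measure ℝ} [IsProbabilityMeasure μ] (h : μ (Iio 0) = 0)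
    {R : ℝ} (hR : 0 < R) :
    μ (Icc (-R) R)ᶜ ≤ ENNReal.ofReal (2 * (1 - ∫ t, Real.exp (-R⁻¹ * t) ∂μ)) := by
  have hR' : 0 ≤ R⁻¹ := by positivity
  have hint := integrable_exp_neg_mul h hR'
  have hint' : Integrable (fun t => 1 - Real.exp (-R⁻¹ * t)) μ := (integrable_const 1).sub hint
  have hnn : 0 ≤ᵐ[μ] fun t => 1 - Real.exp (-R⁻¹ * t) := by
    filter_upwards [ae_nonneg_of_measure_Iio h] with t ht
    simp only [Pi.zero_apply, sub_nonneg, Real.exp_le_one_iff]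
    nlinarith [mul_nonneg hR' ht]
  have hm := mul_meas_ge_le_integral_of_nonneg hnn hint' (1 / 2)
  rw [integral_sub (integrable_const 1) hint] at hm
  simp only [integral_const, probReal_univ, smul_eq_mul, mul_one] at hm
  have hsub : μ (Icc (-R) R)ᶜ ≤ μ {x | 1 / 2 ≤ 1 - Real.exp (-R⁻¹ * x)} := by
    refine measure_mono_ae ?_
    filter_upwards [ae_nonneg_of_measure_Iio h] with t ht htc
    have htR : R < t := by
      by_contra hc
      exact htc ⟨by linarith, not_lt.1 hc⟩
    change 1 / 2 ≤ 1 - Real.exp (-R⁻¹ * t)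
    have h1 : 1 ≤ R⁻¹ * t := by
      rw [inv_mul_eq_div, le_div_iff₀ hR]
      linarith
    have h2 : Real.exp (-R⁻¹ * t) ≤ Real.exp (-1) := Real.exp_le_exp.2 (by linarith)
    have h3 : Real.exp (-1) ≤ 1 / 2 := by
      rw [Real.exp_neg, one_div]
      apply inv_anti₀ (by norm_num)
      linarith [Real.add_one_le_exp (1 : ℝ)]
    linarith
  refine hsub.trans ?_
  rw [← ofReal_measureReal]
  apply ENNReal.ofReal_le_ofReal
  linarith

/-- Continuity theorem for Laplace transforms on the half line. -/
lemma isLaplace_of_tendsto {φ : ℕ → ℝ → ℝ} {ψ : ℝ → ℝ} (h : ∀ n, IsLaplace (φ n))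
    (lim : ∀ q, 0 ≤ q → Tendsto (fun n => φ n q) atTop (𝓝 (ψ q))) {K s : ℝ} (hs : 0 < s)
    (bd : ∀ n, ∀ q, 0 ≤ q → 1 - φ n q ≤ K * q ^ s) : IsLaplace ψ := by
  choose μ hP hsupp hφ using h
  let P : ℕ → ProbabilityMeasure ℝ := fun n => ⟨μ n, hP n⟩
  have htight : IsTightMeasureSet
      {((ρ : ProbabilityMeasure ℝ) : Measure ℝ) | ρ ∈ Set.range P} := by
    rw [isTightMeasureSet_iff_exists_isCompact_measure_compl_le]
    intro ε hε
    have hlim : Tendsto (fun R : ℝ => ENNReal.ofReal (2 * (K * R⁻¹ ^ s))) atTop (𝓝 0) := by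
      rw [← ENNReal.ofReal_zero]
      apply ENNReal.tendsto_ofReal
      have h1 : Tendsto (fun R : ℝ => R⁻¹ ^ s) atTop (𝓝 (0 ^ s)) :=
        tendsto_inv_atTop_zero.rpow_const (Or.inr hs.le)
      rw [Real.zero_rpow hs.ne'] at h1
      simpa using (h1.const_mul K).const_mul 2
    obtain ⟨R, hRε, hR⟩ := ((hlim.eventually_le_const hε).and (eventually_gt_atTop 0)).exists
    refine ⟨Icc (-R) R, isCompact_Icc, ?_⟩
    rintro _ ⟨_, ⟨n, rfl⟩, rfl⟩
    have := hP n
    refine (measure_compl_Icc_le (hsupp n) hR).trans (le_trans ?_ hRε)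
    apply ENNReal.ofReal_le_ofReal
    have := bd n R⁻¹ (by positivity)
    rw [hφ n R⁻¹ (by positivity)] at this
    linarith
  have hcomp := isCompact_closure_of_isTightMeasureSet htight
  obtain ⟨ρ, -, hρ⟩ := hcomp.ultrafilter_le_nhds ((hyperfilter ℕ).map P) (by
    simp only [le_principal_iff, Ultrafilter.coe_map, mem_map]
    exact Eventually.of_forall fun n => subset_closure ⟨n, rfl⟩)
  have hρ' : Tendsto P (hyperfilter ℕ) (𝓝 ρ) := hρ
  rw [ProbabilityMeasure.tendsto_iff_forall_integral_tendsto] at hρ'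
  have hmeas : Measurable (fun t : ℝ => max t 0) := by fun_prop
  refine ⟨(ρ : Measure ℝ).map (fun t => max t 0), Measure.isProbabilityMeasure_map hmeas.aemeasurable,
    ?_, fun q hq => ?_⟩
  · rw [Measure.map_apply hmeas measurableSet_Iio]
    convert measure_empty (μ := (ρ : Measure ℝ))
    ext t
    simp
  · have hb : ∀ t : ℝ, ‖Real.exp (-q * max t 0)‖ ≤ 1 := fun t => by
      rw [Real.norm_eq_abs, abs_of_pos (Real.exp_pos _), Real.exp_le_one_iff]
      nlinarith [le_max_right t 0]
    let f : BoundedContinuousFunction ℝ ℝ :=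
      BoundedContinuousFunction.ofNormedAddCommGroup (fun t => Real.exp (-q * max t 0))
        (by fun_prop) 1 hb
    have h1 := hρ' f
    have h2 : ∀ n, ∫ t, f t ∂(P n : Measure ℝ) = φ n q := by
      intro n
      rw [hφ n q hq]
      apply integral_congr_ae
      filter_upwards [ae_nonneg_of_measure_Iio (hsupp n)] with t ht
      simp [f, max_eq_left ht]
    simp_rw [h2] at h1
    rw [integral_map hmeas.aemeasurable (by fun_prop)]
    exact tendsto_nhds_unique ((lim q hq).mono_left (Nat.hyperfilter_le_atTop)) h1

/-- The exponential distribution with rate `l`. -/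
noncomputable def expLaw (l : ℝ) : Measure ℝ :=
  (volume.restrict (Ioi 0)).withDensity (fun t => ENNReal.ofReal (l * Real.exp (-l * t)))

lemma integral_expLaw {l : ℝ} (hl : 0 < l) {q : ℝ} (hq : 0 ≤ q) :
    ∫ t, Real.exp (-q * t) ∂(expLaw l) = l / (l + q) := by
  rw [expLaw, integral_withDensity_eq_integral_toReal_smul (by fun_prop) (by simp)]
  have : ∀ t : ℝ, (ENNReal.ofReal (l * Real.exp (-l * t))).toReal • Real.exp (-q * t)
      = l * Real.exp (-(l + q) * t) := fun t => by
    rw [ENNReal.toReal_ofReal (by positivity), smul_eq_mul, mul_assoc, ← Real.exp_add]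
    ring_nf
  simp_rw [this]
  rw [integral_const_mul, integral_exp_mul_Ioi (by linarith)]
  rw [mul_zero, Real.exp_zero, neg_div_neg_eq]
  ring

lemma isProbabilityMeasure_expLaw {l : ℝ} (hl : 0 < l) : IsProbabilityMeasure (expLaw l) := by
  constructor
  rw [expLaw, withDensity_apply _ MeasurableSet.univ, Measure.restrict_univ,
    ← ofReal_integral_eq_lintegral_ofReal ((integrableOn_exp_mul_Ioi (by linarith) 0).const_mul l)
      (Eventually.of_forall fun t => by positivity),
    integral_const_mul, integral_exp_mul_Ioi (by linarith)]
  simp [hl.ne']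

lemma expLaw_Iio (l : ℝ) : expLaw l (Iio 0) = 0 := by
  rw [expLaw, withDensity_apply _ measurableSet_Iio, Measure.restrict_restrict measurableSet_Iio]
  have : Iio (0 : ℝ) ∩ Ioi 0 = ∅ := by
    ext t
    simp only [mem_inter_iff, mem_Iio, mem_Ioi, mem_empty_iff_false, iff_false]
    rintro ⟨h1, h2⟩
    linarith
  simp [this]

/-- If `φ` is the Laplace transform of `X`, this produces the Laplace transform of
`T + e^{aZ} X`, with `T` exponential of rate `l`, `Z` of law `P`, all independent. -/
lemma IsLaplace.perpetuity {φ : ℝ → ℝ} (h : IsLaplace φ) {l : ℝ} (hl : 0 < l) (a : ℝ)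
    (P : Measure ℝ) [IsProbabilityMeasure P] :
    IsLaplace (fun q => l / (l + q) * ∫ z, φ (q * Real.exp (a * z)) ∂P) := by
  obtain ⟨μ, hμ, hsupp, hφ⟩ := h
  have hE := isProbabilityMeasure_expLaw hl
  let F : ℝ × ℝ × ℝ → ℝ := fun p => p.1 + Real.exp (a * p.2.1) * p.2.2
  have hF : Measurable F := by fun_prop
  let ρ : Measure (ℝ × ℝ × ℝ) := (expLaw l).prod (P.prod μ)
  have h1 : ∀ᵐ p ∂ρ, 0 ≤ p.1 :=
    Measure.quasiMeasurePreserving_fst.ae (ae_nonneg_of_measure_Iio (expLaw_Iio l))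
  have h2 : ∀ᵐ p ∂ρ, 0 ≤ p.2.2 :=
    (Measure.quasiMeasurePreserving_snd.comp Measure.quasiMeasurePreserving_snd).ae
      (ae_nonneg_of_measure_Iio hsupp)
  refine ⟨ρ.map F, Measure.isProbabilityMeasure_map hF.aemeasurable, ?_, fun q hq => ?_⟩
  · rw [Measure.map_apply hF measurableSet_Iio, measure_eq_zero_iff_ae_notMem]
    filter_upwards [h1, h2] with p hp1 hp2
    simp only [mem_preimage, mem_Iio, not_lt, F]
    positivity
  · rw [integral_map hF.aemeasurable (by fun_prop)]
    have e : ∀ p : ℝ × ℝ × ℝ, Real.exp (-q * F p) =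
        Real.exp (-q * p.1) * Real.exp (-(q * Real.exp (a * p.2.1)) * p.2.2) := fun p => by
      rw [← Real.exp_add]
      simp only [F]
      ring_nf
    simp_rw [e]
    rw [integral_prod_mul (fun t => Real.exp (-q * t))
      (fun p : ℝ × ℝ => Real.exp (-(q * Real.exp (a * p.1)) * p.2)), integral_expLaw hl hq]
    congr 1
    rw [integral_prod]
    · refine integral_congr_ae (Eventually.of_forall fun z => ?_)
      exact hφ _ (by positivity)
    · refine (integrable_const (1 : ℝ)).mono' (by fun_prop) ?_
      have : ∀ᵐ p ∂(P.prod μ), 0 ≤ p.2 :=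
        Measure.quasiMeasurePreserving_snd.ae (ae_nonneg_of_measure_Iio hsupp)
      filter_upwards [this] with p hp
      rw [Real.norm_eq_abs, abs_of_pos (Real.exp_pos _), Real.exp_le_one_iff]
      have := mul_nonneg (mul_nonneg hq (Real.exp_pos (a * p.1)).le) hp
      linarith

lemma integrable_exp_mul_of_measure_Ioi {Λ : Measure ℝ} [IsFiniteMeasure Λ] (hΛ : Λ (Ioi 1) = 0)
    {u : ℝ} (hu : 0 ≤ u) : Integrable (fun z => Real.exp (u * z)) Λ := by
  refine (integrable_const (Real.exp u)).mono' (by fun_prop) ?_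
  have : ∀ᵐ z ∂Λ, z ∉ Ioi (1 : ℝ) := measure_eq_zero_iff_ae_notMem.1 hΛ
  filter_upwards [this] with z hz
  rw [Real.norm_eq_abs, abs_of_pos (Real.exp_pos _), Real.exp_le_exp]
  simp only [mem_Ioi, not_lt] at hz
  nlinarith

lemma IsLaplace.integrable_comp_exp {φ : ℝ → ℝ} (h : IsLaplace φ) {Λ : Measure ℝ}
    [IsFiniteMeasure Λ] {α : ℝ} (hα : 0 < α) {q : ℝ} (hq : 0 ≤ q) :
    Integrable (fun z => φ (q * Real.exp (α * z))) Λ := by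
  have hmono : Antitone (fun z => φ (q * Real.exp (α * z))) := by
    intro x y hxy
    refine h.antitoneOn (mem_Ici.2 (by positivity)) (mem_Ici.2 (by positivity)) ?_
    gcongr
  refine (integrable_const (1 : ℝ)).mono' hmono.measurable.aestronglyMeasurable
    (Eventually.of_forall fun z => ?_)
  rw [Real.norm_eq_abs, abs_of_nonneg (h.nonneg (by positivity))]
  exact h.le_one (by positivity)

lemma self_le_max_mul_rpow {κ : ℝ} (hκ : 0 < κ) {s : ℝ} (hs : 0 < s) (hs1 : s < 1)
    {q : ℝ} (hq : 0 ≤ q) : q ≤ max 1 κ⁻¹ * q ^ s * (κ + q) := by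
  have hK1 : 1 ≤ max 1 κ⁻¹ := le_max_left _ _
  have hKκ : 1 ≤ max 1 κ⁻¹ * κ := by
    calc (1 : ℝ) = κ⁻¹ * κ := (inv_mul_cancel₀ hκ.ne').symm
      _ ≤ _ := by gcongr; exact le_max_right _ _
  have hqs : 0 ≤ q ^ s := Real.rpow_nonneg hq s
  rcases le_total q 1 with h | h
  · have h1 : q ≤ q ^ s := by
      rcases hq.eq_or_lt with rfl | hq0
      · exact hqs
      · calc q = q ^ (1 : ℝ) := (Real.rpow_one q).symm
          _ ≤ q ^ s := Real.rpow_le_rpow_of_exponent_ge hq0 h hs1.le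
    have h2 : 0 ≤ max 1 κ⁻¹ * q ^ s * q := by positivity
    nlinarith
  · have h1 : 1 ≤ q ^ s := Real.one_le_rpow h hs.le
    have h2 : 0 ≤ max 1 κ⁻¹ * q ^ s * κ := by positivity
    have h3 : 1 ≤ max 1 κ⁻¹ * q ^ s := by nlinarith
    nlinarith

/-- For a pure jump generator of finite activity with a strictly subharmonic exponential, the
equation `∫ (φ(q e^{αz}) - φ(q)) Λ(dz) = q φ(q)` is solved by a Laplace transform. -/
lemma exists_isLaplace_of_jump (Λ : Measure ℝ) [IsFiniteMeasure Λ] (hΛ : Λ (Ioi 1) = 0)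
    {α u κ : ℝ} (hu : 0 < u) (huα : u < α) (hκ : 0 < κ)
    (h : ∫ z, (Real.exp (u * z) - 1) ∂Λ ≤ -κ) :
    ∃ φ, IsLaplace φ ∧
      (∀ q, 0 ≤ q → ∫ z, (φ (q * Real.exp (α * z)) - φ q) ∂Λ = q * φ q) ∧
      ∀ q, 0 ≤ q → 1 - φ q ≤ max 1 κ⁻¹ * q ^ (u / α) := by
  have hα : 0 < α := hu.trans huα
  set s := u / α with hs
  have hs0 : 0 < s := by positivity
  have hs1 : s < 1 := (div_lt_one hα).2 huα
  set K := max 1 κ⁻¹ with hK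
  set l := Λ.real univ with hl
  have hΛ0 : Λ ≠ 0 := by
    rintro rfl
    simp only [integral_zero_measure] at h
    linarith
  have hl0 : 0 < l := by
    rw [hl, Measure.real, ENNReal.toReal_pos_iff]
    exact ⟨Measure.measure_univ_pos.2 hΛ0, measure_lt_top _ _⟩
  have : NeZero Λ := ⟨hΛ0⟩
  let P : Measure ℝ := (Λ univ)⁻¹ • Λ
  let S : (ℝ → ℝ) → ℝ → ℝ := fun φ q => (∫ z, φ (q * Real.exp (α * z)) ∂Λ) / (l + q)
  have hS : ∀ φ, IsLaplace φ → IsLaplace (S φ) := fun φ hφ =>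
    (hφ.perpetuity hl0 α P).congr fun q hq => by
      simp only [P, S, integral_smul_measure, ENNReal.toReal_inv, smul_eq_mul]
      change l / (l + q) * (l⁻¹ * _) = _
      field_simp
  let f : ℕ → ℝ → ℝ := fun k => S^[k] (fun _ => 1)
  have fsucc : ∀ k, f (k + 1) = S (f k) := fun k => Function.iterate_succ_apply' _ _ _
  have hf : ∀ k, IsLaplace (f k) := by
    intro k
    induction k with
    | zero => exact isLaplace_one
    | succ k ih => rw [fsucc]; exact hS _ ih
  have hanti : ∀ k, ∀ q, 0 ≤ q → f (k + 1) q ≤ f k q := by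
    intro k
    induction k with
    | zero => exact fun q hq => (hf 1).le_one hq
    | succ k ih =>
      intro q hq
      have e : ∀ j, f (j + 1) q = (∫ z, f j (q * Real.exp (α * z)) ∂Λ) / (l + q) := fun j => by
        rw [fsucc]
      rw [e (k + 1), e k]
      have : 0 < l + q := by positivity
      refine div_le_div_of_nonneg_right ?_ this.le
      refine integral_mono ((hf _).integrable_comp_exp hα hq) ((hf _).integrable_comp_exp hα hq) ?_
      exact fun z => ih _ (by positivity)
  have hexp := integrable_exp_mul_of_measure_Ioi hΛ hu.le
  have hbd : ∀ k, ∀ q, 0 ≤ q → 1 - f k q ≤ K * q ^ s := by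
    intro k
    induction k with
    | zero =>
      intro q hq
      simp only [f, Function.iterate_zero, id_eq, sub_self]
      positivity
    | succ k ih =>
      intro q hq
      rw [fsucc]
      have hlq : 0 < l + q := by positivity
      have h1 : l - ∫ z, f k (q * Real.exp (α * z)) ∂Λ ≤ K * q ^ s * (l - κ) := by
        have e1 : l - ∫ z, f k (q * Real.exp (α * z)) ∂Λ =
            ∫ z, (1 - f k (q * Real.exp (α * z))) ∂Λ := by
          rw [integral_sub (integrable_const 1) ((hf k).integrable_comp_exp hα hq)]
          simp [hl]
        have e2 : ∫ z, (1 - f k (q * Real.exp (α * z))) ∂Λ ≤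
            ∫ z, K * q ^ s * Real.exp (u * z) ∂Λ := by
          refine integral_mono ((integrable_const 1).sub ((hf k).integrable_comp_exp hα hq))
            (hexp.const_mul _) fun z => ?_
          refine (ih _ (by positivity)).trans (le_of_eq ?_)
          rw [Real.mul_rpow hq (Real.exp_pos _).le, ← Real.exp_mul, ← mul_assoc]
          congr 2
          rw [hs]
          field_simp
        rw [integral_sub hexp (integrable_const 1)] at h
        simp only [integral_const, smul_eq_mul, mul_one] at h
        rw [e1]
        refine e2.trans ?_
        rw [integral_const_mul]
        have : 0 ≤ K * q ^ s := by positivity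
        gcongr
        linarith
      have h2 := self_le_max_mul_rpow hκ hs0 hs1 hq
      rw [← hK] at h2
      have h3 : 1 - S (f k) q = (l + q - ∫ z, f k (q * Real.exp (α * z)) ∂Λ) / (l + q) := by
        simp only [S]
        field_simp
      rw [h3, div_le_iff₀ hlq]
      nlinarith
  let φ : ℝ → ℝ := fun q => ⨅ k, f k q
  have hlim : ∀ q, 0 ≤ q → Tendsto (fun k => f k q) atTop (𝓝 (φ q)) := fun q hq =>
    tendsto_atTop_ciInf (antitone_nat_of_succ_le fun k => hanti k q hq)
      ⟨0, by rintro _ ⟨k, rfl⟩; exact (hf k).nonneg hq⟩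
  have hφ : IsLaplace φ := isLaplace_of_tendsto hf hlim hs0 hbd
  refine ⟨φ, hφ, fun q hq => ?_, fun q hq => ?_⟩
  · have hlq : 0 < l + q := by positivity
    have t1 : Tendsto (fun k => ∫ z, f k (q * Real.exp (α * z)) ∂Λ) atTop
        (𝓝 (∫ z, φ (q * Real.exp (α * z)) ∂Λ)) := by
      refine tendsto_integral_of_dominated_convergence (fun _ => 1)
        (fun k => ((hf k).integrable_comp_exp hα hq).aestronglyMeasurable) (integrable_const 1)
        (fun k => Eventually.of_forall fun z => ?_)
        (Eventually.of_forall fun z => hlim _ (by positivity))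
      rw [Real.norm_eq_abs, abs_of_nonneg ((hf k).nonneg (by positivity))]
      exact (hf k).le_one (by positivity)
    have t2 : Tendsto (fun k => f (k + 1) q) atTop
        (𝓝 ((∫ z, φ (q * Real.exp (α * z)) ∂Λ) / (l + q))) := by
      simp_rw [fsucc]
      exact t1.div_const _
    have t3 := tendsto_nhds_unique t2 ((hlim q hq).comp (tendsto_add_atTop_nat 1))
    rw [div_eq_iff hlq.ne'] at t3
    rw [integral_sub (hφ.integrable_comp_exp hα hq) (integrable_const _), t3]
    simp only [integral_const, smul_eq_mul]
    ring
  · exact le_of_tendsto' ((hlim q hq).const_sub 1) fun k => hbd k q hq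

/-- `F j` is the `j`-th derivative of `F 0`, and all of them are bounded on left half lines. -/
structure IsJet (F : ℕ → ℝ → ℝ) : Prop where
  deriv : ∀ j y, HasDerivAt (F j) (F (j + 1) y) y
  bdd : ∀ j Y, ∃ K, ∀ x ≤ Y, |F j x| ≤ K

lemma IsJet.continuous {F : ℕ → ℝ → ℝ} (h : IsJet F) (j : ℕ) : Continuous (F j) :=
  continuous_iff_continuousAt.2 fun y => (h.deriv j y).continuousAt

lemma IsJet.sub {F G : ℕ → ℝ → ℝ} (hF : IsJet F) (hG : IsJet G) :
    IsJet (fun j y => F j y - G j y) where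
  deriv j y := (hF.deriv j y).sub (hG.deriv j y)
  bdd j Y := by
    obtain ⟨K, hK⟩ := hF.bdd j Y
    obtain ⟨L, hL⟩ := hG.bdd j Y
    exact ⟨K + L, fun x hx => (abs_sub _ _).trans (add_le_add (hK x hx) (hL x hx))⟩

lemma IsJet.const_mul {F : ℕ → ℝ → ℝ} (hF : IsJet F) (c : ℝ) : IsJet (fun j y => c * F j y) where
  deriv j y := (hF.deriv j y).const_mul c
  bdd j Y := by
    obtain ⟨K, hK⟩ := hF.bdd j Y
    refine ⟨|c| * K, fun x hx => ?_⟩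
    rw [abs_mul]
    exact mul_le_mul_of_nonneg_left (hK x hx) (abs_nonneg c)

lemma abs_taylor_one_le {f f' f'' : ℝ → ℝ} {y h M : ℝ} (hM : 0 ≤ M)
    (hf : ∀ x ∈ uIcc y (y + h), HasDerivAt f (f' x) x)
    (hf' : ∀ x ∈ uIcc y (y + h), HasDerivAt f' (f'' x) x)
    (hb : ∀ x ∈ uIcc y (y + h), |f'' x| ≤ M) :
    |f (y + h) - f y - h * f' y| ≤ M * h ^ 2 := by
  have hconv : Convex ℝ (uIcc y (y + h)) := convex_uIcc _ _
  have h1 : ∀ x ∈ uIcc y (y + h), ‖f' x - f' y‖ ≤ M * |h| := fun x hx => by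
    refine (hconv.norm_image_sub_le_of_norm_hasDerivWithin_le
      (fun z hz => (hf' z hz).hasDerivWithinAt) hb left_mem_uIcc hx).trans ?_
    refine mul_le_mul_of_nonneg_left ?_ hM
    have := abs_sub_left_of_mem_uIcc hx
    rw [Real.norm_eq_abs]
    simpa using this
  have h2 := hconv.norm_image_sub_le_of_norm_hasDerivWithin_le
    (f := fun x => f x - x * f' y) (f' := fun x => f' x - f' y)
    (fun z hz => (((hf z hz).sub ((hasDerivAt_id z).mul_const (f' y))).congr_deriv
      (by simp)).hasDerivWithinAt) h1 left_mem_uIcc right_mem_uIcc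
  rw [Real.norm_eq_abs, Real.norm_eq_abs] at h2
  have e1 : f (y + h) - (y + h) * f' y - (f y - y * f' y) = f (y + h) - f y - h * f' y := by ring
  have e2 : M * |h| * |y + h - y| = M * h ^ 2 := by
    rw [add_sub_cancel_left, mul_assoc, abs_mul_abs_self]; ring
  rwa [e1, e2] at h2

lemma IsJet.abs_taylor_le {F : ℕ → ℝ → ℝ} (hF : IsJet F) {y h Y K : ℝ} (hy : y ≤ Y)
    (hh : y + h ≤ Y) (hK : ∀ x ≤ Y, |F 2 x| ≤ K) :
    |F 0 (y + h) - F 0 y - h * F 1 y| ≤ K * h ^ 2 :=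
  abs_taylor_one_le ((abs_nonneg _).trans (hK y hy)) (fun x _ => hF.deriv 0 x)
    (fun x _ => hF.deriv 1 x) (fun x hx => hK x (hx.2.trans (max_le hy hh)))

lemma IsJet.abs_second_difference_le {F : ℕ → ℝ → ℝ} (hF : IsJet F) {y δ K : ℝ} (hδ : 0 ≤ δ)
    (hK : ∀ x ≤ y + δ, |F 3 x| ≤ K) :
    |F 0 (y + δ) + F 0 (y - δ) - 2 * F 0 y - δ ^ 2 * F 2 y| ≤ 2 * K * δ * δ ^ 2 := by
  have hK0 : 0 ≤ K := (abs_nonneg _).trans (hK (y + δ) le_rfl)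
  have hlip : ∀ x ≤ y + δ, |F 2 x - F 2 y| ≤ K * |x - y| := fun x hx =>
    (convex_Iic (y + δ)).norm_image_sub_le_of_norm_hasDerivWithin_le
      (fun z _ => (hF.deriv 2 z).hasDerivWithinAt) hK (mem_Iic.2 (by linarith)) hx
  have hp : ∀ j x, HasDerivAt (fun u => F j (y + u)) (F (j + 1) (y + x)) x := fun j x =>
    (hF.deriv j (y + x)).comp_const_add y x
  have hm : ∀ j x, HasDerivAt (fun u => F j (y - u)) (-F (j + 1) (y - x)) x := fun j x =>
    (hF.deriv j (y - x)).comp_const_sub y x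
  have := abs_taylor_one_le (f := fun u => F 0 (y + u) + F 0 (y - u) - u ^ 2 * F 2 y)
    (f' := fun u => F 1 (y + u) - F 1 (y - u) - 2 * u * F 2 y)
    (f'' := fun u => F 2 (y + u) + F 2 (y - u) - 2 * F 2 y) (y := 0) (h := δ) (M := 2 * K * δ)
    (by positivity)
    (fun x _ => (((hp 0 x).add (hm 0 x)).sub ((hasDerivAt_pow 2 x).mul_const _)).congr_deriv
      (by simp; ring))
    (fun x _ => (((hp 1 x).sub (hm 1 x)).sub
      (((hasDerivAt_id x).const_mul 2).mul_const (F 2 y))).congr_deriv (by simp))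
    (fun x hx => by
      rw [zero_add, uIcc_of_le hδ] at hx
      have h1 := hlip (y + x) (by linarith [hx.2])
      have h2 := hlip (y - x) (by linarith [hx.1])
      have e : F 2 (y + x) + F 2 (y - x) - 2 * F 2 y =
        (F 2 (y + x) - F 2 y) + (F 2 (y - x) - F 2 y) := by ring
      rw [e]
      refine (abs_add_le _ _).trans ((add_le_add h1 h2).trans ?_)
      simp only [add_sub_cancel_left, sub_sub_cancel_left, abs_neg, abs_of_nonneg hx.1]
      nlinarith [hx.2])
  simp only [zero_add, add_zero, sub_zero] at this
  refine le_trans (le_of_eq ?_) this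
  congr 1
  ring

/-- The generator with triplet `(b, σ, ν)` (jumps downwards) applied to a jet. -/
noncomputable def gen (σ b : ℝ) (ν : Measure ℝ) (F : ℕ → ℝ → ℝ) (y : ℝ) : ℝ :=
  b * F 1 y + σ / 2 * F 2 y +
    ∫ r in Ioi (0 : ℝ), (F 0 (y - r) - F 0 y + (if r ≤ 1 then r * F 1 y else 0)) ∂ν

section

variable {ν : Measure ℝ}

lemma integrableOn_min_one_sq (hν : ∫⁻ r in Ioi (0 : ℝ), ENNReal.ofReal (min 1 (r ^ 2)) ∂ν < ⊤) :
    IntegrableOn (fun r => min 1 (r ^ 2)) (Ioi 0) ν := by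
  refine ⟨by fun_prop, ?_⟩
  rw [hasFiniteIntegral_iff_ofReal (Eventually.of_forall fun r => by positivity)]
  exact hν

lemma measure_Ioi_lt_top (hν : ∫⁻ r in Ioi (0 : ℝ), ENNReal.ofReal (min 1 (r ^ 2)) ∂ν < ⊤)
    {ε : ℝ} (hε : 0 < ε) : ν (Ioi ε) < ⊤ := by
  have h1 : ENNReal.ofReal (min 1 (ε ^ 2)) * ν (Ioi ε) ≤
      ∫⁻ r in Ioi (0 : ℝ), ENNReal.ofReal (min 1 (r ^ 2)) ∂ν := by
    rw [← setLIntegral_const]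
    refine (setLIntegral_mono (by fun_prop) fun r hr => ?_).trans
      (lintegral_mono_set (Ioi_subset_Ioi hε.le))
    apply ENNReal.ofReal_le_ofReal
    have : ε < r := hr
    gcongr
  refine ENNReal.lt_top_of_mul_ne_top_right (h1.trans_lt hν).ne ?_
  simp only [ne_eq, ENNReal.ofReal_eq_zero, not_le]
  positivity

lemma jump_bound {F : ℕ → ℝ → ℝ} (hF : IsJet F) {y K : ℝ} (hK0 : ∀ x ≤ y, |F 0 x| ≤ K)
    (hK2 : ∀ x ≤ y, |F 2 x| ≤ K) {r : ℝ} (hr : 0 < r) :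
    |F 0 (y - r) - F 0 y + (if r ≤ 1 then r * F 1 y else 0)| ≤ 2 * K * min 1 (r ^ 2) := by
  have hK : 0 ≤ K := (abs_nonneg _).trans (hK0 y le_rfl)
  split_ifs with h
  · have h1 := hF.abs_taylor_le (h := -r) le_rfl (by linarith) hK2
    have e : F 0 (y - r) - F 0 y + r * F 1 y = F 0 (y + -r) - F 0 y - -r * F 1 y := by
      rw [← sub_eq_add_neg]; ring
    rw [e]
    refine h1.trans ?_
    have : r ^ 2 ≤ 1 := by nlinarith
    rw [min_eq_right this]
    nlinarith [sq_nonneg r]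
  · have : 1 ≤ r ^ 2 := by nlinarith
    rw [min_eq_left this, add_zero]
    refine (abs_sub _ _).trans ?_
    have h1 := hK0 y le_rfl
    have h2 := hK0 (y - r) (by linarith)
    linarith

lemma IsJet.integrableOn_jump
    (hν : ∫⁻ r in Ioi (0 : ℝ), ENNReal.ofReal (min 1 (r ^ 2)) ∂ν < ⊤)
    {F : ℕ → ℝ → ℝ} (hF : IsJet F) (y : ℝ) :
    IntegrableOn (fun r => F 0 (y - r) - F 0 y + (if r ≤ 1 then r * F 1 y else 0)) (Ioi 0) ν := by
  obtain ⟨K, hK⟩ := hF.bdd 0 y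
  obtain ⟨L, hL⟩ := hF.bdd 2 y
  refine ((integrableOn_min_one_sq hν).const_mul (2 * max K L)).mono' ?_ ?_
  · have h1 : Measurable (F 0) := (hF.continuous 0).measurable
    refine Measurable.aestronglyMeasurable ?_
    refine Measurable.add (by fun_prop) (Measurable.ite measurableSet_Iic (by fun_prop) (by fun_prop))
  · filter_upwards [ae_restrict_mem measurableSet_Ioi] with r hr
    exact jump_bound hF (fun x hx => (hK x hx).trans (le_max_left _ _))
      (fun x hx => (hL x hx).trans (le_max_right _ _)) hr

lemma gen_sub (σ b : ℝ) (hν : ∫⁻ r in Ioi (0 : ℝ), ENNReal.ofReal (min 1 (r ^ 2)) ∂ν < ⊤)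
    {F G : ℕ → ℝ → ℝ} (hF : IsJet F) (hG : IsJet G) (y : ℝ) :
    gen σ b ν (fun j y => F j y - G j y) y = gen σ b ν F y - gen σ b ν G y := by
  have := integral_sub (hF.integrableOn_jump hν y) (hG.integrableOn_jump hν y)
  have e : ∀ r, (F 0 (y - r) - G 0 (y - r) - (F 0 y - G 0 y) +
      (if r ≤ 1 then r * (F 1 y - G 1 y) else 0)) =
      (F 0 (y - r) - F 0 y + (if r ≤ 1 then r * F 1 y else 0)) -
      (G 0 (y - r) - G 0 y + (if r ≤ 1 then r * G 1 y else 0)) := fun r => by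
    split_ifs <;> ring
  simp only [gen, e, this]
  ring

lemma gen_const_mul (σ b : ℝ) (F : ℕ → ℝ → ℝ) (c y : ℝ) :
    gen σ b ν (fun j y => c * F j y) y = c * gen σ b ν F y := by
  have e : ∀ r, (c * F 0 (y - r) - c * F 0 y + (if r ≤ 1 then r * (c * F 1 y) else 0)) =
      c * (F 0 (y - r) - F 0 y + (if r ≤ 1 then r * F 1 y else 0)) := fun r => by
    split_ifs <;> ring
  simp only [gen, e, integral_const_mul]
  ring

lemma abs_gen_le {σ : ℝ} (b : ℝ) (hσ : 0 ≤ σ)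
    (hν : ∫⁻ r in Ioi (0 : ℝ), ENNReal.ofReal (min 1 (r ^ 2)) ∂ν < ⊤)
    {F : ℕ → ℝ → ℝ} (hF : IsJet F) {y K : ℝ} (hK : ∀ j ≤ 2, ∀ x ≤ y, |F j x| ≤ K) :
    |gen σ b ν F y| ≤
      K * (|b| + σ / 2 + 2 * ∫ r in Ioi (0 : ℝ), min 1 (r ^ 2) ∂ν) := by
  have h1 : |∫ r in Ioi (0 : ℝ), (F 0 (y - r) - F 0 y + (if r ≤ 1 then r * F 1 y else 0)) ∂ν| ≤
      ∫ r in Ioi (0 : ℝ), 2 * K * min 1 (r ^ 2) ∂ν := by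
    rw [← Real.norm_eq_abs]
    refine norm_integral_le_of_norm_le ((integrableOn_min_one_sq hν).const_mul _) ?_
    filter_upwards [ae_restrict_mem measurableSet_Ioi] with r hr
    exact jump_bound hF (hK 0 (by norm_num)) (hK 2 (by norm_num)) hr
  rw [integral_const_mul] at h1
  have h2 : |b * F 1 y| ≤ |b| * K := by
    rw [abs_mul]; exact mul_le_mul_of_nonneg_left (hK 1 (by norm_num) y le_rfl) (abs_nonneg b)
  have h3 : |σ / 2 * F 2 y| ≤ σ / 2 * K := by
    rw [abs_mul, abs_of_nonneg (by positivity : 0 ≤ σ / 2)]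
    exact mul_le_mul_of_nonneg_left (hK 2 le_rfl y le_rfl) (by positivity)
  rw [gen]
  refine (abs_add_le _ _).trans ?_
  have := abs_add_le (b * F 1 y) (σ / 2 * F 2 y)
  linarith

end

section

variable {ν : Measure ℝ}

lemma tendsto_setIntegral_small
    (hν : ∫⁻ r in Ioi (0 : ℝ), ENNReal.ofReal (min 1 (r ^ 2)) ∂ν < ⊤) :
    Tendsto (fun n : ℕ => ∫ r in Ioc (0 : ℝ) (1 / (n + 1)), min 1 (r ^ 2) ∂ν) atTop (𝓝 0) := by
  have h := tendsto_setIntegral_of_antitone (μ := ν) (f := fun r : ℝ => min 1 (r ^ 2))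
    (s := fun n : ℕ => Ioc (0 : ℝ) (1 / (n + 1))) (fun n => measurableSet_Ioc)
    (fun n m hnm => Ioc_subset_Ioc_right (by
      have : (n : ℝ) ≤ m := by exact_mod_cast hnm
      exact one_div_le_one_div_of_le (by positivity) (by linarith)))
    ⟨0, (integrableOn_min_one_sq hν).mono_set Ioc_subset_Ioi_self⟩
  have e : (⋂ n : ℕ, Ioc (0 : ℝ) (1 / (n + 1))) = ∅ := by
    ext r
    simp only [mem_iInter, mem_Ioc, mem_empty_iff_false, iff_false, not_forall]
    by_cases hr : 0 < r
    · obtain ⟨n, hn⟩ := exists_nat_one_div_lt hr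
      exact ⟨n, fun h => absurd h.2 (not_le.2 hn)⟩
    · exact ⟨0, fun h => hr h.1⟩
  simpa only [e, setIntegral_empty] using h

lemma IsJet.abs_setIntegral_small_jump_le
    (hν : ∫⁻ r in Ioi (0 : ℝ), ENNReal.ofReal (min 1 (r ^ 2)) ∂ν < ⊤)
    {F : ℕ → ℝ → ℝ} (hF : IsJet F) {y K ε : ℝ} (hε1 : ε ≤ 1) (hK : ∀ x ≤ y, |F 2 x| ≤ K) :
    |∫ r in Ioc 0 ε, (F 0 (y - r) - F 0 y + (if r ≤ 1 then r * F 1 y else 0)) ∂ν| ≤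
      K * ∫ r in Ioc 0 ε, min 1 (r ^ 2) ∂ν := by
  rw [← integral_const_mul, ← Real.norm_eq_abs]
  refine norm_integral_le_of_norm_le
    (((integrableOn_min_one_sq hν).mono_set Ioc_subset_Ioi_self).const_mul _) ?_
  filter_upwards [ae_restrict_mem measurableSet_Ioc] with r hr
  have h1 : r ≤ 1 := hr.2.trans hε1
  have h2 : r ^ 2 ≤ 1 := by nlinarith [hr.1]
  have h3 := hF.abs_taylor_le (h := -r) le_rfl (by linarith [hr.1]) hK
  rw [if_pos h1, min_eq_right h2, Real.norm_eq_abs]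
  refine le_trans (le_of_eq ?_) (h3.trans_eq (by ring))
  rw [← sub_eq_add_neg]
  congr 1
  ring

lemma IsJet.integrableOn_large_jump
    (hν : ∫⁻ r in Ioi (0 : ℝ), ENNReal.ofReal (min 1 (r ^ 2)) ∂ν < ⊤)
    {F : ℕ → ℝ → ℝ} (hF : IsJet F) (y : ℝ) {ε : ℝ} (hε : 0 < ε) :
    IntegrableOn (fun r => F 0 (y - r) - F 0 y) (Ioi ε) ν := by
  obtain ⟨K, hK⟩ := hF.bdd 0 y
  have hc := hF.continuous 0
  refine Measure.integrableOn_of_bounded (M := K + K) (measure_Ioi_lt_top hν hε).ne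
    (by fun_prop : Continuous fun r => F 0 (y - r) - F 0 y).aestronglyMeasurable ?_
  filter_upwards [ae_restrict_mem measurableSet_Ioi] with r hr
  have hr' : 0 < r := hε.trans hr
  exact (abs_sub _ _).trans (add_le_add (hK _ (by linarith)) (hK _ le_rfl))

/-- Splitting of the jump part of the generator at level `ε`. -/
lemma IsJet.setIntegral_jump_eq
    (hν : ∫⁻ r in Ioi (0 : ℝ), ENNReal.ofReal (min 1 (r ^ 2)) ∂ν < ⊤)
    {F : ℕ → ℝ → ℝ} (hF : IsJet F) (y : ℝ) {ε : ℝ} (hε : 0 < ε) :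
    ∫ r in Ioi (0 : ℝ), (F 0 (y - r) - F 0 y + (if r ≤ 1 then r * F 1 y else 0)) ∂ν =
      (∫ r in Ioc 0 ε, (F 0 (y - r) - F 0 y + (if r ≤ 1 then r * F 1 y else 0)) ∂ν) +
      ((∫ r in Ioi ε, (F 0 (y - r) - F 0 y) ∂ν) + (∫ r in Ioc ε 1, r ∂ν) * F 1 y) := by
  have hint := hF.integrableOn_jump hν y
  have hlarge := hF.integrableOn_large_jump hν y hε
  rw [← Ioc_union_Ioi_eq_Ioi hε.le, setIntegral_union (Ioc_disjoint_Ioi le_rfl) measurableSet_Ioi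
    (hint.mono_set Ioc_subset_Ioi_self) (hint.mono_set (Ioi_subset_Ioi hε.le))]
  congr 1
  have e : ∀ r : ℝ, (if r ≤ 1 then r * F 1 y else 0) =
      (Iic (1 : ℝ)).indicator (fun r => r * F 1 y) r := fun r => by
    simp [indicator]
  have hind : IntegrableOn (fun r : ℝ => if r ≤ 1 then r * F 1 y else 0) (Ioi ε) ν := by
    refine ((hint.mono_set (Ioi_subset_Ioi hε.le)).sub hlarge).congr (Eventually.of_forall ?_)
    intro r
    simp
  rw [integral_add hlarge hind]
  congr 1
  simp_rw [e]
  rw [setIntegral_indicator measurableSet_Iic, Ioi_inter_Iic, integral_mul_const]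

/-- The generator is approximated, uniformly on jets with controlled second and third
derivatives, by pure jump generators of finite activity. -/
lemma exists_jump_approx {σ : ℝ} (b : ℝ) (hσ : 0 ≤ σ)
    (hν : ∫⁻ r in Ioi (0 : ℝ), ENNReal.ofReal (min 1 (r ^ 2)) ∂ν < ⊤) {η : ℝ} (hη : 0 < η) :
    ∃ Λ : Measure ℝ, IsFiniteMeasure Λ ∧ Λ (Ioi 1) = 0 ∧
      ∀ F, IsJet F → ∀ y K, (∀ x ≤ y + 1, |F 2 x| ≤ K ∧ |F 3 x| ≤ K) →
        |gen σ b ν F y - ∫ z, (F 0 (y + z) - F 0 y) ∂Λ| ≤ η * K := by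
  obtain ⟨n, hn⟩ := ((tendsto_setIntegral_small hν).eventually_le_const (half_pos hη)).exists
  set ε : ℝ := 1 / (n + 1) with hε
  have hε0 : 0 < ε := by positivity
  have hε1 : ε ≤ 1 := by
    rw [hε, div_le_one (by positivity)]
    linarith [n.cast_nonneg (α := ℝ)]
  set D : ℝ := ∫ r in Ioc ε 1, r ∂ν with hD
  have hD0 : 0 ≤ D := setIntegral_nonneg measurableSet_Ioc fun r hr => hε0.le.trans hr.1.le
  set A : ℝ := max b 0 + D with hA
  set B : ℝ := max (-b) 0 with hB
  have hAB : b + D = A - B := by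
    have := max_zero_sub_max_neg_zero_eq_self b
    rw [hA, hB]
    linarith
  have hA0 : 0 ≤ A := by positivity
  have hB0 : 0 ≤ B := by positivity
  set δ : ℝ := min 1 (η / (2 * (A + B + σ + 1))) with hδ
  have hδ0 : 0 < δ := by positivity
  have hδ1 : δ ≤ 1 := min_le_left _ _
  have hδη : (A + B + σ) * δ ≤ η / 2 := by
    have h1 : δ ≤ η / (2 * (A + B + σ + 1)) := min_le_right _ _
    rw [le_div_iff₀ (by positivity)] at h1
    nlinarith
  set p : ℝ := A / δ + σ / (2 * δ ^ 2) with hp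
  set m : ℝ := B / δ + σ / (2 * δ ^ 2) with hm
  have hp0 : 0 ≤ p := by positivity
  have hm0 : 0 ≤ m := by positivity
  have : IsFiniteMeasure (ν.restrict (Ioi ε)) := ⟨by simpa using measure_Ioi_lt_top hν hε0⟩
  let J : Measure ℝ := (ν.restrict (Ioi ε)).map Neg.neg
  refine ⟨J + (ENNReal.ofReal p • Measure.dirac δ + ENNReal.ofReal m • Measure.dirac (-δ)),
    ?_, ?_, ?_⟩
  · have h1 : IsFiniteMeasure (ENNReal.ofReal p • Measure.dirac δ) :=
      Measure.smul_finite _ ENNReal.ofReal_ne_top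
    have h2 : IsFiniteMeasure (ENNReal.ofReal m • Measure.dirac (-δ)) :=
      Measure.smul_finite _ ENNReal.ofReal_ne_top
    infer_instance
  · have h1 : J (Ioi 1) = 0 := by
      rw [Measure.map_apply measurable_neg measurableSet_Ioi,
        Measure.restrict_apply (measurable_neg measurableSet_Ioi)]
      convert measure_empty (μ := ν)
      ext r
      simp only [mem_inter_iff, mem_preimage, mem_Ioi, mem_empty_iff_false, iff_false]
      rintro ⟨h1, h2⟩
      linarith
    have h2 : ¬ 1 < δ := not_lt.2 hδ1
    have h3 : ¬ 1 < -δ := by linarith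
    simp [h1, h2, h3]
  · intro F hF y K hK
    have hc := hF.continuous 0
    have hK0 : 0 ≤ K := (abs_nonneg _).trans (hK y (by linarith)).1
    have hJint : Integrable (fun z => F 0 (y + z) - F 0 y) J := by
      refine (integrable_map_measure (by fun_prop) (by fun_prop)).2 ?_
      exact (hF.integrableOn_large_jump hν y hε0).congr
        (Eventually.of_forall fun r => by simp [sub_eq_add_neg])
    have hd : ∀ c a, Integrable (fun z => F 0 (y + z) - F 0 y)
        (ENNReal.ofReal c • Measure.dirac a) := fun c a =>
      (integrable_dirac (by simp)).smul_measure ENNReal.ofReal_ne_top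
    have hΛ : ∫ z, (F 0 (y + z) - F 0 y)
        ∂(J + (ENNReal.ofReal p • Measure.dirac δ + ENNReal.ofReal m • Measure.dirac (-δ))) =
        (∫ r in Ioi ε, (F 0 (y - r) - F 0 y) ∂ν) +
          (p * (F 0 (y + δ) - F 0 y) + m * (F 0 (y - δ) - F 0 y)) := by
      rw [integral_add_measure hJint ((hd _ _).add_measure (hd _ _)),
        integral_add_measure (hd _ _) (hd _ _), integral_smul_measure, integral_smul_measure,
        integral_dirac, integral_dirac, ENNReal.toReal_ofReal hp0, ENNReal.toReal_ofReal hm0,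
        integral_map (by fun_prop) (by fun_prop)]
      simp only [sub_eq_add_neg, smul_eq_mul]
    have b1 := hF.abs_setIntegral_small_jump_le hν hε1
      (fun x hx => (hK x (by linarith)).1 : ∀ x ≤ y, |F 2 x| ≤ K)
    have b2 := hF.abs_taylor_le (y := y) (h := δ) (Y := y + 1) (by linarith) (by linarith)
      (fun x hx => (hK x hx).1)
    have b3 := hF.abs_taylor_le (y := y) (h := -δ) (Y := y + 1) (by linarith) (by linarith)
      (fun x hx => (hK x hx).1)
    have b4 := hF.abs_second_difference_le (y := y) hδ0.le
      (fun x hx => (hK x (by linarith)).2)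
    rw [hΛ, gen, hF.setIntegral_jump_eq hν y hε0, ← hD]
    set T : ℝ := ∫ r in Ioc 0 ε, (F 0 (y - r) - F 0 y + (if r ≤ 1 then r * F 1 y else 0)) ∂ν
    set L : ℝ := ∫ r in Ioi ε, (F 0 (y - r) - F 0 y) ∂ν
    rw [← sub_eq_add_neg] at b3
    set X := F 0 (y + δ) - F 0 y - δ * F 1 y with hX
    set Y := F 0 (y - δ) - F 0 y - -δ * F 1 y with hY
    set Z := F 0 (y + δ) + F 0 (y - δ) - 2 * F 0 y - δ ^ 2 * F 2 y with hZ
    have key : b * F 1 y + σ / 2 * F 2 y + (T + (L + D * F 1 y)) -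
        (L + (p * (F 0 (y + δ) - F 0 y) + m * (F 0 (y - δ) - F 0 y))) =
        T - A / δ * X - B / δ * Y - σ / (2 * δ ^ 2) * Z := by
      have hbD : b = A - B - D := by linarith
      rw [hX, hY, hZ, hp, hm, hbD]
      field_simp
      ring
    rw [key]
    have c1 : |T| ≤ K * (η / 2) := b1.trans (mul_le_mul_of_nonneg_left hn hK0)
    have c2 : |A / δ * X| ≤ A * δ * K := by
      rw [abs_mul, abs_of_nonneg (by positivity : 0 ≤ A / δ)]
      calc A / δ * |X| ≤ A / δ * (K * δ ^ 2) := by gcongr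
        _ = A * δ * K := by field_simp
    have c3 : |B / δ * Y| ≤ B * δ * K := by
      rw [abs_mul, abs_of_nonneg (by positivity : 0 ≤ B / δ)]
      calc B / δ * |Y| ≤ B / δ * (K * (-δ) ^ 2) := by gcongr
        _ = B * δ * K := by field_simp
    have c4 : |σ / (2 * δ ^ 2) * Z| ≤ σ * δ * K := by
      rw [abs_mul, abs_of_nonneg (by positivity : 0 ≤ σ / (2 * δ ^ 2))]
      calc σ / (2 * δ ^ 2) * |Z| ≤ σ / (2 * δ ^ 2) * (2 * K * δ * δ ^ 2) := by gcongr
        _ = σ * δ * K := by field_simp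
    have c5 : |T - A / δ * X - B / δ * Y - σ / (2 * δ ^ 2) * Z| ≤
        |T| + |A / δ * X| + |B / δ * Y| + |σ / (2 * δ ^ 2) * Z| :=
      (abs_sub _ _).trans (add_le_add_left ((abs_sub _ _).trans
        (add_le_add_left (abs_sub _ _) _)) _)
    have c6 := mul_le_mul_of_nonneg_right hδη hK0
    linarith

/-- Positive maximum principle for the generator. -/
lemma gen_nonpos_of_forall_le {σ : ℝ} (b : ℝ) (hσ : 0 ≤ σ)
    (hν : ∫⁻ r in Ioi (0 : ℝ), ENNReal.ofReal (min 1 (r ^ 2)) ∂ν < ⊤)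
    {F : ℕ → ℝ → ℝ} (hF : IsJet F) {y : ℝ} (hy : ∀ x, F 0 x ≤ F 0 y) : gen σ b ν F y ≤ 0 := by
  obtain ⟨K, hK⟩ := hF.bdd 2 (y + 1)
  obtain ⟨L, hL⟩ := hF.bdd 3 (y + 1)
  have hM : ∀ x ≤ y + 1, |F 2 x| ≤ max K L ∧ |F 3 x| ≤ max K L := fun x hx =>
    ⟨(hK x hx).trans (le_max_left _ _), (hL x hx).trans (le_max_right _ _)⟩
  have h1 : ∀ η > 0, gen σ b ν F y ≤ η * max K L := fun η hη => by
    obtain ⟨Λ, -, -, hΛ⟩ := exists_jump_approx b hσ hν hη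
    have h2 := (abs_le.1 (hΛ F hF y _ hM)).2
    have h3 : ∫ z, (F 0 (y + z) - F 0 y) ∂Λ ≤ 0 :=
      integral_nonpos fun z => sub_nonpos.2 (hy _)
    linarith
  have h4 : Tendsto (fun η : ℝ => η * max K L) (𝓝[>] 0) (𝓝 0) := by
    have : Tendsto (fun η : ℝ => η * max K L) (𝓝 0) (𝓝 (0 * max K L)) :=
      (continuous_id.mul continuous_const).tendsto 0
    rw [zero_mul] at this
    exact this.mono_left nhdsWithin_le_nhds
  exact ge_of_tendsto h4 (eventually_mem_nhdsWithin.mono fun η hη => h1 η hη)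

end

lemma exists_abs_eval_mul_exp_neg_le (P : Polynomial ℝ) :
    ∃ K, ∀ x : ℝ, 0 ≤ x → |P.eval x * Real.exp (-x)| ≤ K := by
  induction P using Polynomial.induction_on' with
  | add p q hp hq =>
    obtain ⟨K, hK⟩ := hp
    obtain ⟨L, hL⟩ := hq
    refine ⟨K + L, fun x hx => ?_⟩
    rw [Polynomial.eval_add, add_mul]
    exact (abs_add_le _ _).trans (add_le_add (hK x hx) (hL x hx))
  | monomial n a =>
    refine ⟨|a| * n.factorial, fun x hx => ?_⟩
    rw [Polynomial.eval_monomial, mul_assoc, abs_mul]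
    refine mul_le_mul_of_nonneg_left ?_ (abs_nonneg a)
    have h := Real.pow_div_factorial_le_exp x hx n
    rw [div_le_iff₀ (by positivity)] at h
    rw [abs_of_nonneg (by positivity), Real.exp_neg, ← div_eq_mul_inv,
      div_le_iff₀ (Real.exp_pos x)]
    linarith

/-- The polynomials `p_j` with `(d/dy)^j exp(-t e^{αy}) = p_j(t e^{αy}) exp(-t e^{αy})`. -/
noncomputable def expPoly (α : ℝ) : ℕ → Polynomial ℝ
  | 0 => 1
  | j + 1 => Polynomial.C α * Polynomial.X * (Polynomial.derivative (expPoly α j) - expPoly α j)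

lemma hasDerivAt_expPoly (α t : ℝ) (j : ℕ) (y : ℝ) :
    HasDerivAt (fun y => (expPoly α j).eval (t * Real.exp (α * y)) *
        Real.exp (-(t * Real.exp (α * y))))
      ((expPoly α (j + 1)).eval (t * Real.exp (α * y)) * Real.exp (-(t * Real.exp (α * y)))) y := by
  have h1 : HasDerivAt (fun y => t * Real.exp (α * y)) (α * (t * Real.exp (α * y))) y :=
    ((((hasDerivAt_id y).const_mul α).exp).const_mul t).congr_deriv (by simp; ring)
  have h2 := ((expPoly α j).hasDerivAt (t * Real.exp (α * y))).comp y h1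
  refine (h2.mul h1.neg.exp).congr_deriv ?_
  simp only [expPoly, Function.comp_apply, Polynomial.eval_mul, Polynomial.eval_C,
    Polynomial.eval_X, Polynomial.eval_sub, Pi.neg_apply]
  ring

/-- In logarithmic scale, Laplace transforms have derivatives bounded by universal constants. -/
lemma exists_isJet_of_isLaplace (α : ℝ) : ∃ K : ℕ → ℝ, ∀ φ, IsLaplace φ →
    ∃ F, IsJet F ∧ (∀ y, F 0 y = φ (Real.exp (α * y))) ∧ ∀ j y, |F j y| ≤ K j := by
  choose K hK using fun j => exists_abs_eval_mul_exp_neg_le (expPoly α j)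
  refine ⟨K, ?_⟩
  rintro φ ⟨μ, hμ, hsupp, hφ⟩
  let f : ℕ → ℝ → ℝ → ℝ := fun j y t =>
    (expPoly α j).eval (t * Real.exp (α * y)) * Real.exp (-(t * Real.exp (α * y)))
  have hmeas : ∀ j y, AEStronglyMeasurable (f j y) μ := fun j y => by
    have := (expPoly α j).continuous
    have : Continuous (f j y) := by fun_prop
    exact this.aestronglyMeasurable
  have hb : ∀ j, ∀ᵐ t ∂μ, ∀ y, ‖f j y t‖ ≤ K j := fun j => by
    filter_upwards [ae_nonneg_of_measure_Iio hsupp] with t ht y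
    exact hK j _ (by positivity)
  have hbd : ∀ j y, |∫ t, f j y t ∂μ| ≤ K j := fun j y => by
    rw [← Real.norm_eq_abs]
    refine (norm_integral_le_of_norm_le (integrable_const (K j))
      ((hb j).mono fun t ht => ht y)).trans_eq ?_
    simp
  refine ⟨fun j y => ∫ t, f j y t ∂μ, ⟨fun j y => ?_, fun j Y => ⟨K j, fun x _ => hbd j x⟩⟩,
    fun y => ?_, hbd⟩
  · exact (hasDerivAt_integral_of_dominated_loc_of_deriv_le (F := f j) (F' := f (j + 1))
      (bound := fun _ => K (j + 1)) univ_mem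
      (Eventually.of_forall fun y => hmeas j y)
      ((integrable_const (K j)).mono' (hmeas j y) ((hb j).mono fun t ht => ht y))
      (hmeas (j + 1) y) ((hb (j + 1)).mono fun t ht y _ => ht y) (integrable_const _)
      (Eventually.of_forall fun t y _ => hasDerivAt_expPoly α t j y)).2
  · rw [hφ _ (Real.exp_pos _).le]
    refine integral_congr_ae (Eventually.of_forall fun t => ?_)
    simp only [f, expPoly, Polynomial.eval_one, one_mul]
    ring_nf

/-- The derivatives of `y ↦ e^{wy}`. -/
noncomputable def expJet (w : ℝ) (j : ℕ) (y : ℝ) : ℝ := w ^ j * Real.exp (w * y)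

lemma isJet_expJet {w : ℝ} (hw : 0 ≤ w) : IsJet (expJet w) where
  deriv j y := ((((hasDerivAt_id y).const_mul w).exp).const_mul (w ^ j)).congr_deriv (by
    simp only [expJet, id]; ring)
  bdd j Y := by
    refine ⟨w ^ j * Real.exp (w * Y), fun x hx => ?_⟩
    rw [expJet, abs_of_nonneg (by positivity)]
    gcongr

lemma expJet_jump (w y r : ℝ) :
    expJet w 0 (y - r) - expJet w 0 y + (if r ≤ 1 then r * expJet w 1 y else 0) =
      Real.exp (w * y) * (Real.exp (-w * r) - 1 + (if r ≤ 1 then w * r else 0)) := by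
  have e : Real.exp (w * (y - r)) = Real.exp (w * y) * Real.exp (-w * r) := by
    rw [← Real.exp_add]; ring_nf
  simp only [expJet, e]
  split_ifs <;> ring

lemma abs_psi_integrand_le {w r : ℝ} (hw : 0 ≤ w) (hr : 0 < r) :
    |Real.exp (-w * r) - 1 + (if r ≤ 1 then w * r else 0)| ≤ 2 * (1 + w ^ 2) * min 1 (r ^ 2) := by
  have h1 : ∀ x ≤ (0 : ℝ), Real.exp (w * x) ≤ 1 := fun x hx => by
    rw [Real.exp_le_one_iff]; nlinarith
  have h := jump_bound (isJet_expJet hw) (y := 0) (K := 1 + w ^ 2)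
    (fun x hx => by
      rw [expJet, pow_zero, one_mul, abs_of_pos (Real.exp_pos _)]
      nlinarith [h1 x hx, sq_nonneg w])
    (fun x hx => by
      rw [expJet, abs_of_nonneg (by positivity)]
      nlinarith [h1 x hx, sq_nonneg w]) hr
  rwa [expJet_jump, mul_zero, Real.exp_zero, one_mul] at h

section

variable {ν : Measure ℝ}

lemma integrableOn_psi (hν : ∫⁻ r in Ioi (0 : ℝ), ENNReal.ofReal (min 1 (r ^ 2)) ∂ν < ⊤)
    {w : ℝ} (hw : 0 ≤ w) :
    IntegrableOn (fun r => Real.exp (-w * r) - 1 + (if r ≤ 1 then w * r else 0)) (Ioi 0) ν := by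
  refine ((isJet_expJet hw).integrableOn_jump hν 0).congr (Eventually.of_forall fun r => ?_)
  simp only [expJet_jump, mul_zero, Real.exp_zero, one_mul]

lemma gen_expJet (σ b w y : ℝ) :
    gen σ b ν (expJet w) y = psi σ b ν w * Real.exp (w * y) := by
  simp only [gen, expJet_jump, integral_const_mul, psi]
  simp only [expJet]
  ring

lemma isJet_tsum {c w : ℕ → ℝ} (hw : ∀ n, 0 ≤ w n)
    (hs : ∀ j y, Summable fun n => |c n| * expJet (w n) j y) :
    IsJet (fun j y => ∑' n, c n * expJet (w n) j y) := by
  have hnorm : ∀ n j y, ‖c n * expJet (w n) j y‖ = |c n| * expJet (w n) j y := fun n j y => by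
    have := hw n
    rw [norm_mul, Real.norm_eq_abs, Real.norm_eq_abs, expJet, abs_of_nonneg (a := _ * _)]
    positivity
  have hmono : ∀ n j x Y, x ≤ Y → ‖c n * expJet (w n) j x‖ ≤ |c n| * expJet (w n) j Y :=
    fun n j x Y h => by
      rw [hnorm]
      have := hw n
      simp only [expJet]
      gcongr
  refine ⟨fun j y => ?_, fun j Y => ?_⟩
  · exact hasDerivAt_tsum_of_isPreconnected (hs (j + 1) (y + 1)) (isOpen_Iio (a := y + 1))
      isPreconnected_Iio (fun n x _ => ((isJet_expJet (hw n)).deriv j x).const_mul (c n))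
      (fun n x hx => hmono n _ x _ (le_of_lt hx)) (mem_Iio.2 (lt_add_one y))
      ((hs j y).of_norm_bounded fun n => (hnorm n j y).le) (mem_Iio.2 (lt_add_one y))
  · exact ⟨_, fun x hx => tsum_of_norm_bounded (hs j Y).hasSum fun n => hmono n j x Y hx⟩

lemma gen_tsum (σ b : ℝ) (hν : ∫⁻ r in Ioi (0 : ℝ), ENNReal.ofReal (min 1 (r ^ 2)) ∂ν < ⊤)
    {c w : ℕ → ℝ} (hw : ∀ n, 0 ≤ w n)
    (hs : ∀ j y, Summable fun n => |c n| * expJet (w n) j y) (y : ℝ) :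
    HasSum (fun n => c n * psi σ b ν (w n) * Real.exp (w n * y))
      (gen σ b ν (fun j y => ∑' n, c n * expJet (w n) j y) y) := by
  have hsum : ∀ j x, Summable fun n => c n * expJet (w n) j x := fun j x =>
    (hs j x).of_norm_bounded fun n => by
      have := hw n
      rw [norm_mul, Real.norm_eq_abs, Real.norm_eq_abs, expJet, abs_of_nonneg (a := _ * _)]
      positivity
  let g : ℕ → ℝ → ℝ := fun n r =>
    c n * (expJet (w n) 0 (y - r) - expJet (w n) 0 y + (if r ≤ 1 then r * expJet (w n) 1 y else 0))
  have hgint : ∀ n, IntegrableOn (g n) (Ioi 0) ν := fun n =>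
    ((isJet_expJet (hw n)).integrableOn_jump hν y).const_mul (c n)
  have hg : ∀ r, HasSum (fun n => g n r) ((∑' n, c n * expJet (w n) 0 (y - r)) -
      (∑' n, c n * expJet (w n) 0 y) +
      (if r ≤ 1 then r * ∑' n, c n * expJet (w n) 1 y else 0)) := fun r => by
    have h1 := ((hsum 0 (y - r)).hasSum.sub (hsum 0 y).hasSum)
    split_ifs with hr
    · refine (h1.add ((hsum 1 y).hasSum.mul_left r)).congr_fun fun n => ?_
      simp only [g, if_pos hr]
      ring
    · refine (h1.add hasSum_zero).congr_fun fun n => ?_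
      simp only [g, if_neg hr]
      ring
  set M := ∫ r in Ioi (0 : ℝ), min 1 (r ^ 2) ∂ν with hM
  have hgnorm : Summable fun n => ∫ r in Ioi (0 : ℝ), ‖g n r‖ ∂ν := by
    have hb : Summable fun n => 2 * M * (|c n| * expJet (w n) 0 y + |c n| * expJet (w n) 2 y) :=
      ((hs 0 y).add (hs 2 y)).mul_left (2 * M)
    refine Summable.of_nonneg_of_le (fun n => by positivity) (fun n => ?_) hb
    have e : 2 * M * (|c n| * expJet (w n) 0 y + |c n| * expJet (w n) 2 y) =
        ∫ r in Ioi (0 : ℝ), (|c n| * Real.exp (w n * y) * (2 * (1 + w n ^ 2))) * min 1 (r ^ 2) ∂ν := by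
      rw [integral_const_mul, ← hM]
      simp only [expJet]
      ring
    rw [e]
    refine integral_mono_ae (hgint n).norm ((integrableOn_min_one_sq hν).const_mul _) ?_
    filter_upwards [ae_restrict_mem measurableSet_Ioi] with r hr
    simp only [g, expJet_jump, norm_mul, Real.norm_eq_abs, abs_of_pos (Real.exp_pos _)]
    rw [← mul_assoc, mul_assoc _ (2 * (1 + w n ^ 2))]
    exact mul_le_mul_of_nonneg_left (abs_psi_integrand_le (hw n) hr) (by positivity)
  have hI := hasSum_integral_of_summable_integral_norm hgint hgnorm
  have e : ∀ r, ∑' n, g n r = _ := fun r => (hg r).tsum_eq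
  simp_rw [e] at hI
  have := (((hsum 1 y).hasSum.mul_left b).add ((hsum 2 y).hasSum.mul_left (σ / 2))).add hI
  refine this.congr_fun fun n => ?_
  have h := gen_expJet (ν := ν) σ b (w n) y
  simp only [g, integral_const_mul]
  rw [mul_assoc, ← h, gen]
  ring

end

lemma psi_zero (σ b : ℝ) (ν : Measure ℝ) : psi σ b ν 0 = 0 := by
  simp [psi]

section

variable {σ : ℝ} {ν : Measure ℝ}

lemma convexOn_psi (b : ℝ) (hσ : 0 ≤ σ)
    (hν : ∫⁻ r in Ioi (0 : ℝ), ENNReal.ofReal (min 1 (r ^ 2)) ∂ν < ⊤) :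
    ConvexOn ℝ (Ici 0) (psi σ b ν) := by
  refine ⟨convex_Ici 0, fun x hx y hy s t hs ht hst => ?_⟩
  simp only [smul_eq_mul]
  have hx0 : 0 ≤ x := hx
  have hy0 : 0 ≤ y := hy
  have hI := integral_mono (integrableOn_psi hν (w := s * x + t * y) (by positivity))
    (((integrableOn_psi hν hx0).const_mul s).add ((integrableOn_psi hν hy0).const_mul t))
    fun r => by
      have h := convexOn_exp.2 (mem_univ (-x * r)) (mem_univ (-y * r)) hs ht hst
      simp only [smul_eq_mul] at h
      have e : s * (-x * r) + t * (-y * r) = -(s * x + t * y) * r := by ring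
      rw [e] at h
      simp only [Pi.add_apply]
      split_ifs <;> linear_combination h + (1 : ℝ) * hst
  rw [integral_add' ((integrableOn_psi hν hx0).const_mul s) ((integrableOn_psi hν hy0).const_mul t),
    integral_const_mul, integral_const_mul] at hI
  have hsq : (s * x + t * y) ^ 2 ≤ s * x ^ 2 + t * y ^ 2 := by
    obtain rfl : t = 1 - s := by linarith
    nlinarith [mul_nonneg (mul_nonneg hs ht) (sq_nonneg (x - y))]
  simp only [psi]
  nlinarith [mul_le_mul_of_nonneg_left hsq (show 0 ≤ σ / 2 by positivity)]

/-- A Laplace exponent that is nonnegative near `0` has a nonnegative derivative at `0`. -/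
lemma integrableOn_Ioi_one_of_psi_nonneg {b : ℝ}
    (hν : ∫⁻ r in Ioi (0 : ℝ), ENNReal.ofReal (min 1 (r ^ 2)) ∂ν < ⊤)
    {θ : ℝ} (hθ : 0 < θ) (h : ∀ u, 0 < u → u < θ → 0 ≤ psi σ b ν u) :
    IntegrableOn (fun r => r) (Ioi 1) ν ∧ 0 ≤ b - ∫ r in Ioi (1 : ℝ), r ∂ν := by
  set c := ∫ r in Ioi (0 : ℝ), min 1 (r ^ 2) ∂ν with hc
  have hI1 : ∀ u, 0 ≤ u → IntegrableOn (fun r => 1 - Real.exp (-u * r)) (Ioi 1) ν := fun u hu => by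
    refine ((integrableOn_psi hν hu).mono_set (Ioi_subset_Ioi zero_le_one)).neg.congr ?_
    filter_upwards [ae_restrict_mem measurableSet_Ioi] with r hr
    simp [not_le.2 (mem_Ioi.1 hr)]
  have key : ∀ u, 0 < u → u ≤ 1 → u < θ →
      ∫ r in Ioi (1 : ℝ), (1 - Real.exp (-u * r)) ∂ν ≤ u * (b + (σ / 2 + c) * u) := by
    intro u hu hu1 huθ
    have hind : Integrable ((Ioi (1 : ℝ)).indicator (fun r => 1 - Real.exp (-u * r)))
        (ν.restrict (Ioi 0)) := by
      rw [integrable_indicator_iff measurableSet_Ioi, IntegrableOn,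
        Measure.restrict_restrict measurableSet_Ioi,
        inter_eq_self_of_subset_left (Ioi_subset_Ioi zero_le_one)]
      exact hI1 u hu.le
    have h1 : ∫ r in Ioi (0 : ℝ), (Real.exp (-u * r) - 1 + (if r ≤ 1 then u * r else 0)) ∂ν ≤
        ∫ r in Ioi (0 : ℝ), (u ^ 2 * min 1 (r ^ 2) -
          (Ioi (1 : ℝ)).indicator (fun r => 1 - Real.exp (-u * r)) r) ∂ν := by
      refine integral_mono_ae (integrableOn_psi hν hu.le)
        (((integrableOn_min_one_sq hν).const_mul _).sub hind) ?_
      filter_upwards [ae_restrict_mem measurableSet_Ioi] with r hr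
      have hr0 : 0 < r := hr
      by_cases hr1 : r ≤ 1
      · have h2 := (abs_le.1 (Real.abs_exp_sub_one_sub_id_le (x := -u * r)
          (by rw [abs_le]; constructor <;> nlinarith))).2
        have h3 : min 1 (r ^ 2) = r ^ 2 := min_eq_right (by nlinarith)
        rw [indicator_of_notMem (by simpa using hr1), if_pos hr1, h3]
        linarith
      · rw [indicator_of_mem (by simpa using hr1), if_neg hr1]
        have : 0 ≤ u ^ 2 * min 1 (r ^ 2) := by positivity
        linarith
    rw [integral_sub ((integrableOn_min_one_sq hν).const_mul _) hind, integral_const_mul,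
      integral_indicator measurableSet_Ioi, Measure.restrict_restrict measurableSet_Ioi,
      inter_eq_self_of_subset_left (Ioi_subset_Ioi zero_le_one)] at h1
    have h2 := h u hu huθ
    rw [psi] at h2
    linarith
  have hu : Tendsto (fun n : ℕ => (1 : ℝ) / (n + 1)) atTop (𝓝 0) :=
    tendsto_one_div_add_atTop_nhds_zero_nat
  have hlim : Tendsto (fun n : ℕ => b + (σ / 2 + c) * ((1 : ℝ) / (n + 1))) atTop (𝓝 b) := by
    simpa using (hu.const_mul (σ / 2 + c)).const_add b
  have hev : ∀ᶠ n : ℕ in atTop, (1 : ℝ) / (n + 1) < θ := hu.eventually (gt_mem_nhds hθ)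
  have hnn : ∀ u > (0 : ℝ), ∀ r ∈ Ioi (1 : ℝ), 0 ≤ 1 - Real.exp (-u * r) := fun u hu r hr => by
    have : 1 < r := hr
    rw [sub_nonneg, Real.exp_le_one_iff]
    nlinarith
  have hb : 0 ≤ b := by
    refine ge_of_tendsto hlim ?_
    filter_upwards [hev] with n hn
    have hn0 : (0 : ℝ) < 1 / (n + 1) := by positivity
    have hn1 : (1 : ℝ) / (n + 1) ≤ 1 := by
      rw [div_le_one (by positivity)]
      linarith [n.cast_nonneg (α := ℝ)]
    have := (setIntegral_nonneg measurableSet_Ioi (hnn _ hn0)).trans (key _ hn0 hn1 hn)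
    exact nonneg_of_mul_nonneg_right this hn0
  have hfatou : ∫⁻ r in Ioi (1 : ℝ), ENNReal.ofReal r ∂ν ≤ ENNReal.ofReal b := by
    have hpt : ∀ r : ℝ, Tendsto (fun n : ℕ =>
        ENNReal.ofReal ((1 - Real.exp (-(1 / ((n : ℝ) + 1)) * r)) / (1 / (n + 1)))) atTop
        (𝓝 (ENNReal.ofReal r)) := fun r => by
      refine (ENNReal.continuous_ofReal.tendsto _).comp ?_
      have hd : HasDerivAt (fun u : ℝ => 1 - Real.exp (-u * r)) r 0 :=
        (((hasDerivAt_id (0 : ℝ)).neg.mul_const r).exp.const_sub 1).congr_deriv (by simp)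
      have h1 := (hasDerivAt_iff_tendsto_slope_zero.1 hd).comp
        (tendsto_nhdsWithin_iff.2 ⟨hu, Eventually.of_forall fun n => by
          simp only [mem_compl_iff, mem_singleton_iff]; positivity⟩)
      refine h1.congr fun n => ?_
      simp [div_eq_inv_mul]
    calc ∫⁻ r in Ioi (1 : ℝ), ENNReal.ofReal r ∂ν
        = ∫⁻ r in Ioi (1 : ℝ), liminf (fun n : ℕ =>
          ENNReal.ofReal ((1 - Real.exp (-(1 / ((n : ℝ) + 1)) * r)) / (1 / (n + 1)))) atTop ∂ν :=
          lintegral_congr fun r => (hpt r).liminf_eq.symm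
      _ ≤ liminf (fun n : ℕ => ∫⁻ r in Ioi (1 : ℝ),
          ENNReal.ofReal ((1 - Real.exp (-(1 / ((n : ℝ) + 1)) * r)) / (1 / (n + 1))) ∂ν) atTop :=
          lintegral_liminf_le fun n => by fun_prop
      _ ≤ liminf (fun n : ℕ => ENNReal.ofReal (b + (σ / 2 + c) * ((1 : ℝ) / (n + 1)))) atTop := by
          refine liminf_le_liminf ?_
          filter_upwards [hev] with n hn
          have hn0 : (0 : ℝ) < 1 / (n + 1) := by positivity
          have hn1 : (1 : ℝ) / (n + 1) ≤ 1 := by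
            rw [div_le_one (by positivity)]
            linarith [n.cast_nonneg (α := ℝ)]
          rw [← ofReal_integral_eq_lintegral_ofReal ((hI1 _ hn0.le).div_const _)
            ((ae_restrict_mem measurableSet_Ioi).mono fun r hr =>
              div_nonneg (hnn _ hn0 r hr) hn0.le), integral_div]
          refine ENNReal.ofReal_le_ofReal ((div_le_iff₀' hn0).2 (key _ hn0 hn1 hn))
      _ = ENNReal.ofReal b := ((ENNReal.continuous_ofReal.tendsto b).comp hlim).liminf_eq
  have hpos : 0 ≤ᵐ[ν.restrict (Ioi 1)] fun r : ℝ => r :=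
    (ae_restrict_mem measurableSet_Ioi).mono fun r hr => zero_le_one.trans (le_of_lt hr)
  have hint : IntegrableOn (fun r => r) (Ioi 1) ν := by
    refine ⟨by fun_prop, ?_⟩
    rw [hasFiniteIntegral_iff_ofReal hpos]
    exact hfatou.trans_lt ENNReal.ofReal_lt_top
  refine ⟨hint, ?_⟩
  rw [← ofReal_integral_eq_lintegral_ofReal hint hpos] at hfatou
  linarith [(ENNReal.ofReal_le_ofReal_iff hb).1 hfatou]

end

lemma ConvexOn.slope_mul_le_of_root {f : ℝ → ℝ} (hf : ConvexOn ℝ (Ici 0) f) {u θ x : ℝ}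
    (hu : 0 ≤ u) (huθ : u < θ) (hθ : f θ = 0) (hx : θ < x) :
    -f u / (θ - u) * (x - θ) ≤ f x := by
  have h := hf.slope_mono_adjacent (mem_Ici.2 hu) (mem_Ici.2 (by linarith)) huθ hx
  rw [hθ, zero_sub, sub_zero] at h
  exact (le_div_iff₀ (sub_pos.2 hx)).1 h

lemma coeffA_succ_mul {f : ℝ → ℝ} {α : ℝ} {n : ℕ} (h : f (α * (n + 1)) ≠ 0) :
    coeffA f α (n + 1) * f (α * (n + 1)) = coeffA f α n := by
  rw [coeffA, coeffA, Finset.prod_range_succ, mul_inv, mul_assoc, inv_mul_cancel₀ h, mul_one]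

lemma coeffA_pos {f : ℝ → ℝ} {α : ℝ} (h : ∀ n : ℕ, 0 < f (α * (n + 1))) (n : ℕ) :
    0 < coeffA f α n :=
  inv_pos.2 (Finset.prod_pos fun k _ => h k)

lemma summable_coeffA_mul_pow {f : ℝ → ℝ} {α : ℝ} (h : ∀ n : ℕ, 0 < f (α * (n + 1)))
    (htop : Tendsto (fun n : ℕ => f (α * (n + 1))) atTop atTop) {x : ℝ} (hx : 0 < x) :
    Summable fun n => coeffA f α n * x ^ n := by
  have hc := coeffA_pos h
  refine summable_of_ratio_test_tendsto_lt_one (l := 0) zero_lt_one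
    (Eventually.of_forall fun n => (mul_pos (hc n) (pow_pos hx n)).ne') ?_
  refine (htop.const_div_atTop x).congr fun n => ?_
  have h1 := hc (n + 1)
  have h2 := h n
  rw [← coeffA_succ_mul h2.ne', Real.norm_of_nonneg (by positivity),
    Real.norm_of_nonneg (by positivity), pow_succ]
  field_simp

lemma Iser_zero (f : ℝ → ℝ) (α : ℝ) : Iser f α 0 = 1 := by
  rw [Iser, tsum_eq_single 0 fun n hn => by simp [hn]]
  simp [coeffA]

/-- The function `y ↦ e^{βy} I(e^{αy})` is an eigenfunction of the generator killed by `e^{αy}`. -/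
lemma exists_isJet_Iser (σ b : ℝ) {ν : Measure ℝ}
    (hν : ∫⁻ r in Ioi (0 : ℝ), ENNReal.ofReal (min 1 (r ^ 2)) ∂ν < ⊤)
    {α β : ℝ} (hα : 0 < α) (hβ : 0 ≤ β) (hroot : psi σ b ν β = 0)
    (hp : ∀ n : ℕ, 0 < psi σ b ν (α * (n + 1) + β))
    (htop : Tendsto (fun n : ℕ => psi σ b ν (α * (n + 1) + β)) atTop atTop) :
    ∃ F, IsJet F ∧
      (∀ y, F 0 y = Real.exp (β * y) *
        Iser (fun u => psi σ b ν (u + β) - psi σ b ν β) α (Real.exp (α * y))) ∧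
      (∀ y, gen σ b ν F y = Real.exp (α * y) * F 0 y) ∧
      (∀ y, Real.exp (β * y) ≤ F 0 y) ∧
      ∃ L, ∀ y ≤ 0, F 0 y ≤ Real.exp (β * y) * (1 + L * Real.exp (α * y)) := by
  simp only [hroot, sub_zero]
  set f : ℝ → ℝ := fun u => psi σ b ν (u + β) with hf
  set c := coeffA f α with hcdef
  set w : ℕ → ℝ := fun n => α * n + β with hwdef
  have hc : ∀ n, 0 < c n := coeffA_pos hp
  have hw : ∀ n, 0 ≤ w n := fun n => by positivity
  have hexp : ∀ n y, Real.exp (w n * y) = Real.exp (β * y) * Real.exp (α * y) ^ n := fun n y => by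
    rw [← Real.exp_nat_mul, ← Real.exp_add]
    simp only [hwdef]
    ring_nf
  have hsum : ∀ y, Summable fun n => c n * Real.exp (α * y) ^ n := fun y =>
    summable_coeffA_mul_pow hp htop (Real.exp_pos _)
  have hs : ∀ j y, Summable fun n => |c n| * expJet (w n) j y := fun j y => by
    refine Summable.of_nonneg_of_le (fun n => ?_) (fun n => ?_)
      ((hsum (y + 1)).mul_left (j.factorial * Real.exp (β * (y + 1))))
    · have := hw n
      rw [expJet]
      positivity
    · have h1 := Real.pow_div_factorial_le_exp (w n) (hw n) j
      rw [div_le_iff₀ (by positivity)] at h1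
      rw [expJet, abs_of_pos (hc n)]
      calc c n * (w n ^ j * Real.exp (w n * y))
          ≤ c n * ((Real.exp (w n) * j.factorial) * Real.exp (w n * y)) := by
            have := (hc n).le
            gcongr
        _ = j.factorial * c n * Real.exp (w n * (y + 1)) := by
            rw [mul_add, mul_one, Real.exp_add (w n * y) (w n)]
            ring
        _ = _ := by
            rw [hexp]
            ring
  have hF0 : ∀ y, ∑' n, c n * expJet (w n) 0 y = Real.exp (β * y) * Iser f α (Real.exp (α * y)) :=
    fun y => by
      rw [Iser, ← tsum_mul_left]
      refine tsum_congr fun n => ?_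
      rw [expJet, pow_zero, one_mul, hexp]
      ring
  have hIone : ∀ y, Iser f α (Real.exp (α * y)) =
      1 + ∑' n, c (n + 1) * Real.exp (α * y) ^ (n + 1) := fun y => by
    rw [Iser, (hsum y).tsum_eq_zero_add]
    simp [hcdef, coeffA]
  have htail : ∀ y, Summable fun n => c (n + 1) * Real.exp (α * y) ^ (n + 1) := fun y =>
    (summable_nat_add_iff 1).2 (hsum y)
  refine ⟨_, isJet_tsum hw hs, hF0, fun y => ?_, fun y => ?_,
    ∑' n, c (n + 1) * Real.exp (α * 0) ^ (n + 1), fun y hy => ?_⟩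
  · have h1 := gen_tsum σ b hν hw hs y
    rw [← h1.tsum_eq, h1.summable.tsum_eq_zero_add]
    have h0 : psi σ b ν (w 0) = 0 := by simpa [hwdef] using hroot
    rw [h0, mul_zero, zero_mul, zero_add, hF0, Iser, ← mul_assoc, ← tsum_mul_left]
    refine tsum_congr fun n => ?_
    have h2 : psi σ b ν (w (n + 1)) = f (α * (n + 1)) := by simp [hwdef, hf]
    rw [h2, coeffA_succ_mul (hp n).ne', hexp, pow_succ]
    ring
  · rw [hF0, hIone]
    refine le_mul_of_one_le_right (Real.exp_pos _).le (le_add_of_nonneg_right ?_)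
    exact tsum_nonneg fun n => by have := hc (n + 1); positivity
  · rw [hF0, hIone]
    refine mul_le_mul_of_nonneg_left (add_le_add le_rfl ?_) (Real.exp_pos _).le
    rw [← tsum_mul_right]
    refine (htail y).tsum_le_tsum (fun n => ?_) ((htail 0).mul_right _)
    have h1 : Real.exp (α * y) ≤ 1 := by rw [Real.exp_le_one_iff]; nlinarith
    have h2 := hc (n + 1)
    rw [mul_zero, Real.exp_zero, one_pow, mul_one, pow_succ]
    refine mul_le_mul_of_nonneg_left ?_ h2.le
    exact mul_le_of_le_one_left (Real.exp_pos _).le (pow_le_one₀ (Real.exp_pos _).le h1)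

lemma measure_Iic_eq_zero {μ : Measure ℝ} [IsProbabilityMeasure μ] (h : μ (Iio 0) = 0) {C : ℝ}
    (hC : ∀ q, 0 < q → q * ∫ t, Real.exp (-q * t) ∂μ ≤ C) : μ (Iic 0) = 0 := by
  have key : ∀ q, 0 < q → μ.real (Iic 0) ≤ C / q := fun q hq => by
    rw [le_div_iff₀' hq]
    refine le_trans (mul_le_mul_of_nonneg_left ?_ hq.le) (hC q hq)
    rw [← integral_indicator_one measurableSet_Iic]
    refine integral_mono ((integrable_const 1).indicator measurableSet_Iic)
      (integrable_exp_neg_mul h hq.le) fun t => ?_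
    by_cases ht : t ∈ Iic 0
    · rw [indicator_of_mem ht]
      have : t ≤ 0 := ht
      exact Real.one_le_exp (by nlinarith)
    · rw [indicator_of_notMem ht]
      positivity
  have hlim : Tendsto (fun q : ℝ => C / q) atTop (𝓝 0) := tendsto_const_nhds.div_atTop tendsto_id
  have h0 := ge_of_tendsto hlim ((eventually_gt_atTop 0).mono key)
  exact (measureReal_eq_zero_iff).1 (le_antisymm h0 measureReal_nonneg)

section

variable {σ : ℝ} {ν : Measure ℝ}

lemma le_max_of_le_gen (b : ℝ) (hσ : 0 ≤ σ)
    (hν : ∫⁻ r in Ioi (0 : ℝ), ENNReal.ofReal (min 1 (r ^ 2)) ∂ν < ⊤)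
    {M : ℕ → ℝ → ℝ} (hM : IsJet M) {α δ η Y Z : ℝ} (hα : 0 ≤ α) (hδ : 0 ≤ δ) (hη : 0 ≤ η)
    (hgen : ∀ y, Real.exp (α * y) * M 0 y - δ ≤ gen σ b ν M y)
    (hY : ∀ y ≤ Y, M 0 y ≤ η) (hZ : ∀ y, Z ≤ y → M 0 y ≤ 0) (y : ℝ) :
    M 0 y ≤ max η (δ * Real.exp (-(α * Y))) := by
  by_contra! hy
  have hηy := (le_max_left _ _).trans_lt hy
  have hmem : ∀ x, η < M 0 x → x ∈ Icc Y Z := fun x hx => by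
    constructor
    · by_contra! h
      exact hx.not_ge (hY x h.le)
    · by_contra! h
      linarith [hZ x h.le]
  obtain ⟨z, hz, hzmax⟩ := isCompact_Icc.exists_isMaxOn ⟨y, hmem y hηy⟩
    (hM.continuous 0).continuousOn
  have hyz : M 0 y ≤ M 0 z := hzmax (hmem y hηy)
  have hg := gen_nonpos_of_forall_le b hσ hν hM (y := z) fun x => by
    by_cases hx : η < M 0 x
    · exact hzmax (hmem x hx)
    · linarith
  have h1 : M 0 z ≤ δ * Real.exp (-(α * z)) := by
    rw [Real.exp_neg, ← div_eq_mul_inv, le_div_iff₀' (Real.exp_pos _)]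
    linarith [hgen z]
  have h2 : δ * Real.exp (-(α * z)) ≤ δ * Real.exp (-(α * Y)) := by
    have := hz.1
    gcongr
  linarith [le_max_right η (δ * Real.exp (-(α * Y)))]

/-- Comparison principle for functions of slower growth than a positive eigenfunction. -/
lemma le_max_of_le_gen_of_tendsto_div (b : ℝ) (hσ : 0 ≤ σ)
    (hν : ∫⁻ r in Ioi (0 : ℝ), ENNReal.ofReal (min 1 (r ^ 2)) ∂ν < ⊤)
    {M G : ℕ → ℝ → ℝ} (hM : IsJet M) (hG : IsJet G) {α δ η Y : ℝ} (hα : 0 ≤ α) (hδ : 0 ≤ δ)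
    (hη : 0 ≤ η) (hgen : ∀ y, Real.exp (α * y) * M 0 y - δ ≤ gen σ b ν M y)
    (hGgen : ∀ y, gen σ b ν G y = Real.exp (α * y) * G 0 y) (hGpos : ∀ y, 0 < G 0 y)
    (hlim : Tendsto (fun y => M 0 y / G 0 y) atTop (𝓝 0))
    (hY : ∀ y ≤ Y, M 0 y ≤ η) (y : ℝ) :
    M 0 y ≤ max η (δ * Real.exp (-(α * Y))) := by
  have key : ∀ ε > 0, M 0 y ≤ max η (δ * Real.exp (-(α * Y))) + ε * G 0 y := fun ε hε => by
    obtain ⟨Z, hZ⟩ := eventually_atTop.1 (hlim.eventually_le_const hε)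
    have h := le_max_of_le_gen b hσ hν (hM.sub (hG.const_mul ε)) hα hδ hη (Y := Y) (Z := Z)
      (fun x => by
        rw [gen_sub σ b hν hM (hG.const_mul ε), gen_const_mul, hGgen]
        linarith [hgen x])
      (fun x hx => by linarith [hY x hx, mul_pos hε (hGpos x)])
      (fun x hx => by linarith [(div_le_iff₀ (hGpos x)).1 (hZ x hx)]) y
    linarith
  have hcont : Tendsto (fun ε : ℝ => max η (δ * Real.exp (-(α * Y))) + ε * G 0 y) (𝓝[>] 0)
      (𝓝 (max η (δ * Real.exp (-(α * Y))) + 0 * G 0 y)) :=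
    ((continuous_const.add (continuous_id.mul continuous_const)).tendsto 0).mono_left
      nhdsWithin_le_nhds
  rw [zero_mul, add_zero] at hcont
  exact ge_of_tendsto hcont (eventually_mem_nhdsWithin.mono key)

lemma exists_isLaplace_approx {b : ℝ} (hσ : 0 ≤ σ)
    (hν : ∫⁻ r in Ioi (0 : ℝ), ENNReal.ofReal (min 1 (r ^ 2)) ∂ν < ⊤)
    {α u η : ℝ} (hu : 0 < u) (huα : u < α) (hneg : psi σ b ν u < 0) (hη : 0 < η) :
    ∃ φ, IsLaplace φ ∧
      (∀ q, 0 ≤ q → 1 - φ q ≤ max 1 (-psi σ b ν u / 2)⁻¹ * q ^ (u / α)) ∧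
      ∀ H, IsJet H → (∀ y, H 0 y = φ (Real.exp (α * y))) →
        ∀ K, (∀ y, |H 2 y| ≤ K ∧ |H 3 y| ≤ K) →
          ∀ y, |gen σ b ν H y - Real.exp (α * y) * H 0 y| ≤ η * K := by
  set κ := -psi σ b ν u / 2 with hκdef
  have hκ : 0 < κ := by linarith
  set L := (u ^ 2 + u ^ 3) * Real.exp u with hL
  have hL0 : 0 < L := by positivity
  obtain ⟨Λ, hfin, hsupp, hΛ⟩ := exists_jump_approx b hσ hν (lt_min hη (div_pos hκ hL0))
  have hexp : ∫ z, (Real.exp (u * z) - 1) ∂Λ ≤ -κ := by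
    have hle : ∀ x ≤ (0 : ℝ) + 1, Real.exp (u * x) ≤ Real.exp u := fun x hx =>
      Real.exp_le_exp.2 (by nlinarith)
    have h1 := hΛ _ (isJet_expJet hu.le) 0 L fun x hx => by
      constructor
      all_goals
        rw [expJet, abs_of_nonneg (by positivity), hL]
        refine mul_le_mul ?_ (hle x hx) (Real.exp_pos _).le (by positivity)
      · linarith [pow_pos hu 3]
      · linarith [pow_pos hu 2]
    have h2 : min η (κ / L) * L ≤ κ := by
      rw [← le_div_iff₀ hL0]
      exact min_le_right _ _
    have h3 := (abs_le.1 (h1.trans h2)).1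
    rw [gen_expJet] at h3
    simp only [expJet, zero_add, mul_zero, Real.exp_zero, pow_zero, one_mul, mul_one] at h3
    linarith
  obtain ⟨φ, hφ, heq, hbd⟩ := exists_isLaplace_of_jump Λ hsupp hu huα hκ hexp
  refine ⟨φ, hφ, hbd, fun H hH hH0 K hK y => ?_⟩
  have h1 := hΛ H hH y K fun x _ => hK x
  have h2 : ∫ z, (H 0 (y + z) - H 0 y) ∂Λ = Real.exp (α * y) * H 0 y := by
    simp only [hH0, mul_add, Real.exp_add]
    exact heq _ (Real.exp_pos _).le
  rw [h2] at h1
  have hK0 : 0 ≤ K := (abs_nonneg _).trans (hK 0).1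
  exact h1.trans (mul_le_mul_of_nonneg_right (min_le_left _ _) hK0)

end

section

variable {σ : ℝ} {ν : Measure ℝ}

/-- A bounded-at-`-∞` eigenfunction of slower growth than a positive one is a Laplace transform. -/
lemma isLaplace_and_bound_of_eigenfunction {b : ℝ} (hσ : 0 ≤ σ)
    (hν : ∫⁻ r in Ioi (0 : ℝ), ENNReal.ofReal (min 1 (r ^ 2)) ∂ν < ⊤)
    {α u : ℝ} (hu : 0 < u) (huα : u < α) (hneg : psi σ b ν u < 0)
    {N G : ℕ → ℝ → ℝ} (hN : IsJet N) (hG : IsJet G)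
    (hNgen : ∀ y, gen σ b ν N y = Real.exp (α * y) * N 0 y)
    (hGgen : ∀ y, gen σ b ν G y = Real.exp (α * y) * G 0 y) (hGpos : ∀ y, 0 < G 0 y)
    (hGtop : Tendsto (G 0) atTop atTop)
    (hNG : Tendsto (fun y => N 0 y / G 0 y) atTop (𝓝 0)) (hNbot : Tendsto (N 0) atBot (𝓝 1))
    {Φ : ℝ → ℝ} (hΦ : ∀ y, N 0 y = Φ (Real.exp (α * y))) (hΦ0 : Φ 0 = 1) :
    IsLaplace Φ ∧ ∃ C, ∀ q, 0 < q → q * Φ q ≤ C := by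
  have hα : 0 < α := hu.trans huα
  obtain ⟨K, hK⟩ := exists_isJet_of_isLaplace α
  have hη : ∀ n : ℕ, (0 : ℝ) < 1 / (n + 1) := fun n => by positivity
  choose φ hφ hbd happ using fun n => exists_isLaplace_approx hσ hν hu huα hneg (hη n)
  choose H hH hH0 hHK using fun n => hK (φ n) (hφ n)
  set κ := max 1 (-psi σ b ν u / 2)⁻¹ with hκ
  set L := max (K 2) (K 3) with hLdef
  have hKnn : ∀ j, 0 ≤ K j := fun j => (abs_nonneg _).trans (hHK 0 j 0)
  have hL0 : 0 ≤ L := (hKnn 2).trans (le_max_left _ _)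
  have hgen : ∀ n y, |gen σ b ν (H n) y - Real.exp (α * y) * H n 0 y| ≤ 1 / ((n : ℝ) + 1) * L :=
    fun n => happ n (H n) (hH n) (hH0 n) L fun y =>
      ⟨(hHK n 2 y).trans (le_max_left _ _), (hHK n 3 y).trans (le_max_right _ _)⟩
  have hHnn : ∀ n y, 0 ≤ H n 0 y := fun n y => by
    rw [hH0]
    exact (hφ n).nonneg (Real.exp_pos _).le
  have hHle : ∀ n y, H n 0 y ≤ 1 := fun n y => by
    rw [hH0]
    exact (hφ n).le_one (Real.exp_pos _).le
  have hHbot : ∀ n y, 1 - H n 0 y ≤ κ * Real.exp (u * y) := fun n y => by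
    rw [hH0]
    refine (hbd n _ (Real.exp_pos _).le).trans_eq ?_
    rw [← Real.exp_mul, mul_right_comm, mul_div_cancel₀ _ hα.ne']
  have hHG : ∀ n, Tendsto (fun y => H n 0 y / G 0 y) atTop (𝓝 0) := fun n => by
    refine squeeze_zero (fun y => div_nonneg (hHnn n y) (hGpos y).le) (fun y => ?_)
      hGtop.inv_tendsto_atTop
    rw [div_eq_mul_inv]
    exact mul_le_of_le_one_left (inv_nonneg.2 (hGpos y).le) (hHle n y)
  have hδ : Tendsto (fun n : ℕ => 1 / ((n : ℝ) + 1)) atTop (𝓝 0) :=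
    tendsto_one_div_add_atTop_nhds_zero_nat
  have hconv : ∀ y, Tendsto (fun n => H n 0 y) atTop (𝓝 (N 0 y)) := by
    intro y
    rw [Metric.tendsto_atTop']
    intro ε hε
    have h1 : ∀ᶠ x in atBot, |N 0 x - 1| ≤ ε / 4 := by
      have := (hNbot.sub_const 1).abs
      rw [sub_self, abs_zero] at this
      exact this.eventually_le_const (by positivity)
    have h2 : ∀ᶠ x in atBot, κ * Real.exp (u * x) ≤ ε / 4 := by
      have := ((Real.tendsto_exp_atBot.comp (tendsto_id.const_mul_atBot hu)).const_mul κ)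
      rw [mul_zero] at this
      exact this.eventually_le_const (by positivity)
    obtain ⟨Y, hY⟩ := eventually_atBot.1 (h1.and h2)
    have hYb : ∀ n, ∀ x ≤ Y, |N 0 x - H n 0 x| ≤ ε / 2 := fun n x hx => by
      obtain ⟨h3, h4⟩ := hY x hx
      have h5 := hHle n x
      have h6 := hHbot n x
      rw [abs_le] at h3 ⊢
      constructor <;> linarith
    have h3 : ∀ᶠ n : ℕ in atTop, 1 / ((n : ℝ) + 1) * L * Real.exp (-(α * Y)) ≤ ε / 2 := by
      have := (hδ.mul_const L).mul_const (Real.exp (-(α * Y)))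
      rw [zero_mul, zero_mul] at this
      exact this.eventually_le_const (by positivity)
    obtain ⟨n₀, hn₀⟩ := eventually_atTop.1 h3
    refine ⟨n₀, fun n hn => ?_⟩
    have hn' := hn₀ n hn.le
    have hδn : 0 ≤ 1 / ((n : ℝ) + 1) * L := mul_nonneg (hη n).le hL0
    have e1 := le_max_of_le_gen_of_tendsto_div b hσ hν (hN.sub (hH n)) hG hα.le hδn
      (half_pos hε).le (fun x => by
        rw [gen_sub σ b hν hN (hH n), hNgen]
        linarith [(abs_le.1 (hgen n x)).2]) hGgen hGpos
      (by simpa only [sub_div, sub_zero] using hNG.sub (hHG n))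
      (fun x hx => (abs_le.1 (hYb n x hx)).2) y
    have e2 := le_max_of_le_gen_of_tendsto_div b hσ hν ((hH n).sub hN) hG hα.le hδn
      (half_pos hε).le (fun x => by
        rw [gen_sub σ b hν (hH n) hN, hNgen]
        linarith [(abs_le.1 (hgen n x)).1]) hGgen hGpos
      (by simpa only [sub_div, sub_zero] using (hHG n).sub hNG)
      (fun x hx => by linarith [(abs_le.1 (hYb n x hx)).1]) y
    rw [max_eq_left hn'] at e1 e2
    rw [Real.dist_eq]
    exact (abs_le.2 ⟨by linarith, e2⟩).trans_lt (half_lt_self hε)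
  have hlog : ∀ q, 0 < q → Real.exp (α * (Real.log q / α)) = q := fun q hq => by
    rw [mul_div_cancel₀ _ hα.ne', Real.exp_log hq]
  refine ⟨isLaplace_of_tendsto hφ (fun q hq => ?_) (div_pos hu hα) hbd, ?_⟩
  · rcases hq.eq_or_lt with rfl | hq
    · simp only [(hφ _).zero, hΦ0]
      exact tendsto_const_nhds
    · have h := hconv (Real.log q / α)
      simpa only [hH0, hΦ, hlog q hq] using h
  · set L' := max (K 0) (max (K 1) (K 2)) with hL'
    set A := |b| + σ / 2 + 2 * ∫ r in Ioi (0 : ℝ), min 1 (r ^ 2) ∂ν with hA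
    refine ⟨L' * A + L, fun q hq => ?_⟩
    have h := (hconv (Real.log q / α)).const_mul (Real.exp (α * (Real.log q / α)))
    rw [hΦ, hlog q hq] at h
    refine le_of_tendsto' h fun n => ?_
    have h1 := (abs_le.1 (hgen n (Real.log q / α))).1
    rw [hlog q hq] at h1
    have h2 := (abs_le.1 (abs_gen_le b hσ hν (hH n) (y := Real.log q / α) (K := L')
      fun j hj x _ => (hHK n j x).trans (by interval_cases j <;> simp [hL']))).2
    rw [← hA] at h2
    have h3 : 1 / ((n : ℝ) + 1) * L ≤ L := by
      refine mul_le_of_le_one_left hL0 ?_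
      rw [div_le_one (by positivity)]
      linarith [n.cast_nonneg (α := ℝ)]
    linarith

end

/-- Theorem 2.2, Laplace transform of the exponential functional: `N_{α,ψ,θ}` is the Laplace
transform of a probability measure on `(0,∞)`; in particular `N_{α,ψ,θ}(0) = 1` and
`N_{α,ψ,θ}` is nonincreasing on `[0,∞)`. -/
theorem Nfun_laplace_transform (σ b : ℝ) (ν : Measure ℝ)
    (hσ : 0 ≤ σ)
    (hν : ∫⁻ r in Ioi (0 : ℝ), ENNReal.ofReal (min 1 (r ^ 2)) ∂ν < ⊤)
    (hnd : 0 < σ ∨ ν (Ioi 0) ≠ 0 ∨ b ≠ 0)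
    (hns : 0 < σ ∨ ¬ IntegrableOn (fun r => r) (Ioc 0 1) ν ∨
      0 < b - ∫ r in Ioc (0 : ℝ) 1, r ∂ν)
    (hm : ¬ IntegrableOn (fun r => r) (Ioi 1) ν ∨ b - ∫ r in Ioi (1 : ℝ), r ∂ν < 0)
    (α θ C : ℝ) (hθpos : 0 < θ) (hθα : θ < α)
    (hθroot : psi σ b ν θ = 0) (hC : 0 < C)
    (hCasymp : Tendsto (fun x : ℝ =>
        Iser (psi σ b ν) α (x ^ α) /
          (x ^ θ * Iser (fun u => psi σ b ν (u + θ) - psi σ b ν θ) α (x ^ α)))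
      atTop (𝓝 C)) :
    (∃ μ : Measure ℝ, IsProbabilityMeasure μ ∧ μ (Iic 0) = 0 ∧
      ∀ q : ℝ, 0 ≤ q →
        Nfun (psi σ b ν) (fun u => psi σ b ν (u + θ) - psi σ b ν θ) α θ C q =
          ∫ t, Real.exp (-q * t) ∂μ) ∧
    Nfun (psi σ b ν) (fun u => psi σ b ν (u + θ) - psi σ b ν θ) α θ C 0 = 1 ∧
    AntitoneOn (Nfun (psi σ b ν) (fun u => psi σ b ν (u + θ) - psi σ b ν θ) α θ C)
      (Ici 0) := by
  have hα : 0 < α := hθpos.trans hθα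
  obtain ⟨u, hu, huθ, hneg⟩ : ∃ u, 0 < u ∧ u < θ ∧ psi σ b ν u < 0 := by
    by_contra! h
    obtain ⟨h1, h2⟩ := integrableOn_Ioi_one_of_psi_nonneg hν hθpos h
    exact hm.elim (fun h => h h1) (fun h => h.not_ge h2)
  set s := -psi σ b ν u / (θ - u) with hs
  have hs0 : 0 < s := div_pos (neg_pos.2 hneg) (sub_pos.2 huθ)
  have hgrowth : ∀ x, θ < x → s * (x - θ) ≤ psi σ b ν x := fun x hx =>
    (convexOn_psi b hσ hν).slope_mul_le_of_root hu.le huθ hθroot hx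
  have hlarge : ∀ β, 0 ≤ β → ∀ n : ℕ, θ < α * (n + 1) + β := fun β hβ n => by
    nlinarith [n.cast_nonneg (α := ℝ), mul_nonneg hα.le (n.cast_nonneg (α := ℝ))]
  have hp : ∀ β, 0 ≤ β → ∀ n : ℕ, 0 < psi σ b ν (α * (n + 1) + β) := fun β hβ n =>
    (mul_pos hs0 (sub_pos.2 (hlarge β hβ n))).trans_le (hgrowth _ (hlarge β hβ n))
  have htop : ∀ β, 0 ≤ β → Tendsto (fun n : ℕ => psi σ b ν (α * (n + 1) + β)) atTop atTop :=
    fun β hβ => by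
      refine tendsto_atTop_mono (fun n => hgrowth _ (hlarge β hβ n)) ?_
      refine Tendsto.const_mul_atTop hs0 (tendsto_atTop_add_const_right _ _
        (tendsto_atTop_add_const_right _ _ (Tendsto.const_mul_atTop hα ?_)))
      exact tendsto_atTop_add_const_right _ _ tendsto_natCast_atTop_atTop
  obtain ⟨F, hF, hF0, hFgen, hFge, L, hFle⟩ :=
    exists_isJet_Iser σ b hν hα le_rfl (psi_zero σ b ν) (hp 0 le_rfl) (htop 0 le_rfl)
  obtain ⟨G, hG, hG0, hGgen, hGge, L', hGle⟩ :=
    exists_isJet_Iser σ b hν hα hθpos.le hθroot (hp θ hθpos.le) (htop θ hθpos.le)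
  simp only [zero_mul, Real.exp_zero, one_mul, add_zero, psi_zero, sub_zero] at hF0 hFge hFle
  have hGpos : ∀ y, 0 < G 0 y := fun y => (Real.exp_pos _).trans_le (hGge y)
  have hGtop : Tendsto (G 0) atTop atTop :=
    tendsto_atTop_mono hGge (Real.tendsto_exp_atTop.comp (tendsto_id.const_mul_atTop hθpos))
  have hexp : ∀ w, 0 < w → Tendsto (fun y => Real.exp (w * y)) atBot (𝓝 0) := fun w hw =>
    Real.tendsto_exp_atBot.comp (tendsto_id.const_mul_atBot hw)
  have hneg0 := eventually_le_atBot (0 : ℝ)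
  have hFbot : Tendsto (F 0) atBot (𝓝 1) := by
    have h := ((hexp α hα).const_mul L).const_add 1
    rw [mul_zero, add_zero] at h
    exact tendsto_of_tendsto_of_tendsto_of_le_of_le' tendsto_const_nhds h
      (Eventually.of_forall hFge) (hneg0.mono hFle)
  have hGbot : Tendsto (G 0) atBot (𝓝 0) := by
    have h := (hexp θ hθpos).mul (((hexp α hα).const_mul L').const_add 1)
    rw [zero_mul] at h
    exact tendsto_of_tendsto_of_tendsto_of_le_of_le' tendsto_const_nhds h
      (Eventually.of_forall fun y => (hGpos y).le) (hneg0.mono hGle)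
  have hFG : Tendsto (fun y => F 0 y / G 0 y) atTop (𝓝 C) := by
    refine (hCasymp.comp Real.tendsto_exp_atTop).congr fun y => ?_
    simp only [Function.comp_apply, ← Real.exp_mul, hF0, hG0, mul_comm y]
  have hN0 : Nfun (psi σ b ν) (fun u => psi σ b ν (u + θ) - psi σ b ν θ) α θ C 0 = 1 := by
    rw [Nfun, Iser_zero, Real.zero_rpow (div_pos hθpos hα).ne', mul_zero, zero_mul, sub_zero]
  obtain ⟨hlap, K, hK⟩ := isLaplace_and_bound_of_eigenfunction hσ hν hu (huθ.trans hθα) hneg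
    (hF.sub (hG.const_mul C)) hG
    (fun y => by
      rw [gen_sub σ b hν hF (hG.const_mul C), gen_const_mul, hFgen, hGgen]
      ring) hGgen hGpos hGtop
    (by
      have h := hFG.sub_const C
      rw [sub_self] at h
      refine h.congr fun y => ?_
      rw [sub_div, mul_div_cancel_right₀ _ (hGpos y).ne'])
    (by simpa using hFbot.sub (hGbot.const_mul C))
    (Φ := Nfun (psi σ b ν) (fun u => psi σ b ν (u + θ) - psi σ b ν θ) α θ C)
    (fun y => by
      rw [hF0, hG0, Nfun, ← Real.exp_mul (α * y), mul_right_comm α y,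
        mul_div_cancel₀ _ hα.ne']
      ring) hN0
  refine ⟨?_, hN0, hlap.antitoneOn⟩
  obtain ⟨μ, hμ, hsupp, hq⟩ := hlap
  exact ⟨μ, hμ, measure_Iic_eq_zero hsupp fun q h => (hq q h.le) ▸ hK q h, hq⟩
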